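/- arXiv:2111.08122 — 10 statements merged into one kernel-verified Lean document; each statement's English description precedes it below -/
import Mathlib

section
/- Let L be a finite lattice. If m ∈ L is meet-irreducible with unique cover m^*, then every minimal element of the set {z ∈ L : m ∨ z = m^*} is join-irreducible. Dually, if j ∈ L is join-irreducible with j_* the unique element it covers, then every maximal element of the set {z ∈ L : j ∧ z = j_*} is meet-irreducible. -/
universe u

/-- An element of a lattice is join-irreducible if it covers exactly one element. -/
def JoinIrred {α : Type u} [Lattice α] (j : α) : Prop := ∃! y : α, y ⋖ j

/-- An element of a lattice is meet-irreducible if it is covered by exactly one element. -/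
def MeetIrred {α : Type u} [Lattice α] (m : α) : Prop := ∃! y : α, m ⋖ y

/-- `j` is join-prime if `j ≤ x ⊔ y` implies `j ≤ x` or `j ≤ y`. -/
def JoinPrime {α : Type u} [Lattice α] (j : α) : Prop :=
  ∀ x y : α, j ≤ x ⊔ y → j ≤ x ∨ j ≤ y

/-- `m` is meet-prime if `x ⊓ y ≤ m` implies `x ≤ m` or `y ≤ m`. -/
def MeetPrime {α : Type u} [Lattice α] (m : α) : Prop :=
  ∀ x y : α, x ⊓ y ≤ m → x ≤ m ∨ y ≤ m

/-- `(j0, m0)` is a prime pair: the lattice is the disjoint union of `[⊥, m0]` and `[j0, ⊤]`,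
i.e. every element satisfies exactly one of `z ≤ m0` or `j0 ≤ z`. -/
def IsPrimePair {α : Type u} [Lattice α] (j0 m0 : α) : Prop :=
  ∀ z : α, (z ≤ m0 ∨ j0 ≤ z) ∧ ¬(z ≤ m0 ∧ j0 ≤ z)

/-- A pairing is a bijection `κ` from join-irreducibles to meet-irreducibles such that
`κ j` is maximal in `{z | j ⊓ z = j_*}` and `j = κ⁻¹ (κ j)` is minimal in
`{z | κ j ⊔ z = (κ j)^*}`. -/
def IsPairing {α : Type u} [Lattice α]
    (κ : {j : α // JoinIrred j} → {m : α // MeetIrred m}) : Prop :=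
  Function.Bijective κ ∧
    (∀ (j : {j : α // JoinIrred j}) (jst : α), jst ⋖ j.1 →
      Maximal (fun z : α => j.1 ⊓ z = jst) (κ j).1) ∧
    (∀ (j : {j : α // JoinIrred j}) (mst : α), (κ j).1 ⋖ mst →
      Minimal (fun z : α => (κ j).1 ⊔ z = mst) j.1)

/-- The edge relation of the Galois graph: `j → j'` iff `j ≠ j'` and `j ≰ κ j'`. -/
def GaloisEdge {α : Type u} [Lattice α]
    (κ : {j : α // JoinIrred j} → {m : α // MeetIrred m})
    (j j' : {j : α // JoinIrred j}) : Prop :=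
  j ≠ j' ∧ ¬ j.1 ≤ (κ j').1

/-- Independent sets of the Galois graph (no edge in either direction). -/
def IndepSet {α : Type u} [Lattice α]
    (κ : {j : α // JoinIrred j} → {m : α // MeetIrred m})
    (S : Set {j : α // JoinIrred j}) : Prop :=
  ∀ j ∈ S, ∀ j' ∈ S, ¬ GaloisEdge κ j j'

/-- The downward label set `D_L(x)`: labels of the cover relations `y ⋖ x`. -/
def DLabel {α : Type u} [Lattice α]
    (κ : {j : α // JoinIrred j} → {m : α // MeetIrred m}) (x : α) :
    Set {j : α // JoinIrred j} :=
  {j | ∃ y : α, y ⋖ x ∧ j.1 ≤ x ∧ y ≤ (κ j).1}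

/-- The upward label set `U_L(x)`: labels of the cover relations `x ⋖ y`. -/
def ULabel {α : Type u} [Lattice α]
    (κ : {j : α // JoinIrred j} → {m : α // MeetIrred m}) (x : α) :
    Set {j : α // JoinIrred j} :=
  {j | ∃ y : α, x ⋖ y ∧ j.1 ≤ y ∧ x ≤ (κ j).1}

/-- A uniquely paired lattice is overlapping if every cover relation has a unique label. -/
def Overlapping {α : Type u} [Lattice α]
    (κ : {j : α // JoinIrred j} → {m : α // MeetIrred m}) : Prop :=
  ∀ x y : α, x ⋖ y → ∃! j : {j : α // JoinIrred j}, j.1 ≤ y ∧ x ≤ (κ j).1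

theorem aux_min {α : Type u} [Lattice α] (m mst z : α) (h : m ⋖ mst)
    (hz : Minimal (fun w : α => m ⊔ w = mst) z) : ∃! y : α, y ⋖ z := by
  have h1 : m ⊔ z = mst := hz.prop
  have hnle : ¬ z ≤ m := fun hle => h.lt.ne (by rw [← h1, sup_eq_left.2 hle])
  have key : ∀ y, y < z → y ≤ m ⊓ z := by
    intro y hy
    refine le_inf ?_ hy.le
    have h2 : m ⊔ y ≤ mst := h1 ▸ sup_le_sup_left hy.le m
    rcases h.eq_or_eq le_sup_left h2 with h3 | h3
    · exact sup_eq_left.1 h3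
    · exact absurd (hz.le_of_le h3 hy.le) hy.not_ge
  have hlt : m ⊓ z < z := lt_of_le_of_ne inf_le_right (fun e => hnle (inf_eq_right.1 e))
  refine ⟨m ⊓ z, ⟨hlt, fun c hc hcz => absurd (key c hcz) hc.not_ge⟩, ?_⟩
  intro y hy
  rcases hy.eq_or_eq (key y hy.lt) inf_le_right with e | e
  · exact e.symm
  · exact absurd e hlt.ne

theorem aux_max {α : Type u} [Lattice α] (j jst z : α) (h : jst ⋖ j)
    (hz : Maximal (fun w : α => j ⊓ w = jst) z) : ∃! y : α, z ⋖ y := by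
  have h1 : j ⊓ z = jst := hz.prop
  have hnle : ¬ j ≤ z := fun hle => h.lt.ne (by rw [← h1, inf_eq_left.2 hle])
  have key : ∀ y, z < y → j ⊔ z ≤ y := by
    intro y hy
    refine sup_le ?_ hy.le
    have h2 : jst ≤ j ⊓ y := h1 ▸ inf_le_inf_left j hy.le
    rcases h.eq_or_eq h2 inf_le_left with h3 | h3
    · exact absurd (hz.le_of_ge h3 hy.le) hy.not_ge
    · exact inf_eq_left.1 h3
  have hlt : z < j ⊔ z := lt_of_le_of_ne le_sup_right (fun e => hnle (sup_eq_right.1 e.symm))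
  refine ⟨j ⊔ z, ⟨hlt, fun c hc hcz => absurd (key c hc) hcz.not_ge⟩, ?_⟩
  intro y hy
  rcases hy.eq_or_eq le_sup_right (key y hy.lt) with e | e
  · exact absurd e hlt.ne'
  · exact e.symm

/-- minimal elements of `{z | m ⊔ z = m^*}` are join-irreducible, and dually
maximal elements of `{z | j ⊓ z = j_*}` are meet-irreducible. -/
theorem stmt1 {α : Type u} [Lattice α] [Finite α] :
    (∀ m mst z : α, MeetIrred m → m ⋖ mst →
      Minimal (fun w : α => m ⊔ w = mst) z → JoinIrred z) ∧
    (∀ j jst z : α, JoinIrred j → jst ⋖ j →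
      Maximal (fun w : α => j ⊓ w = jst) z → MeetIrred z) := by
  exact ⟨fun m mst z _ h hz => aux_min m mst z h hz,
    fun j jst z _ h hz => aux_max j jst z h hz⟩
end

section
/- Let L be a finite lattice, let κ be a pairing on L, and let (j0, m0) be a prime pair for L. Then κ(j0) = m0. -/
universe u

/-- a pairing sends the join-prime element of a prime pair to the
corresponding meet-prime element. -/
theorem stmt3 {α : Type u} [Lattice α] [Finite α]
    (κ : {j : α // JoinIrred j} → {m : α // MeetIrred m})
    (hκ : IsPairing κ) (j0 m0 : α) (hpp : IsPrimePair j0 m0)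
    (hj : JoinIrred j0) :
    (κ ⟨j0, hj⟩).1 = m0 := by
  obtain ⟨s, hs, -⟩ := id hj
  have hM := hκ.2.1 ⟨j0, hj⟩ s hs
  have hk : j0 ⊓ (κ ⟨j0, hj⟩).1 = s := hM.1
  have h1 : (κ ⟨j0, hj⟩).1 ≤ m0 := by
    rcases (hpp (κ ⟨j0, hj⟩).1).1 with h | h
    · exact h
    · rw [inf_eq_left.mpr h] at hk
      exact absurd hk.symm hs.lt.ne
  have hsm : s ≤ m0 := by
    rcases (hpp s).1 with h | h
    · exact h
    · exact absurd h hs.lt.not_ge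
  have hj0 : ¬ j0 ≤ m0 := fun h => (hpp m0).2 ⟨le_rfl, h⟩
  have h2 : j0 ⊓ m0 = s := by
    rcases hs.eq_or_eq (le_inf hs.le hsm) inf_le_left with h | h
    · exact h
    · exact absurd (inf_eq_left.mp h) hj0
  exact le_antisymm h1 (hM.2 h2 h1)
end

section
/- Every finite semidistributive lattice is uniquely paired; that is, a finite semidistributive lattice has exactly one pairing. -/
universe u

/-- Join-semidistributivity. -/
def JoinSemidistributive (α : Type u) [Lattice α] : Prop :=
  ∀ x y z : α, x ⊔ y = x ⊔ z → x ⊔ (y ⊓ z) = x ⊔ y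

/-- Meet-semidistributivity. -/
def MeetSemidistributive (α : Type u) [Lattice α] : Prop :=
  ∀ x y z : α, x ⊓ y = x ⊓ z → x ⊓ (y ⊔ z) = x ⊓ y

theorem aux_greatest {α : Type u} [Lattice α] [Finite α] (h2 : MeetSemidistributive α)
    {j a : α} (haj : a ⋖ j) :
    ∃ k : α, (j ⊓ k = a ∧ ∀ z, j ⊓ z = a → z ≤ k) ∧ k < k ⊔ j ∧ ∀ y, k < y → k ⊔ j ≤ y := by
  have hne : {z : α | j ⊓ z = a}.Nonempty := ⟨a, inf_eq_right.2 haj.le⟩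
  obtain ⟨k, hk⟩ := (Set.toFinite {z : α | j ⊓ z = a}).exists_maximal hne
  have hk1 : j ⊓ k = a := hk.1
  have hgr : ∀ z, j ⊓ z = a → z ≤ k := by
    intro z hz
    have h := h2 j k z (hk1.trans hz.symm)
    have h' : k ⊔ z ≤ k := hk.2 (show j ⊓ (k ⊔ z) = a from h.trans hk1) le_sup_left
    exact le_sup_right.trans h'
  refine ⟨k, ⟨hk1, hgr⟩, ?_, ?_⟩
  · refine lt_of_le_of_ne le_sup_left fun h => ?_
    have : j ≤ k := sup_eq_left.1 h.symm
    rw [inf_eq_left.2 this] at hk1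
    exact haj.lt.ne hk1.symm
  · intro y hy
    have hle : a ≤ j ⊓ y := by
      rw [← hk1]; exact inf_le_inf_left _ hy.le
    rcases haj.eq_or_eq hle inf_le_left with h | h
    · exact absurd (hgr y h) hy.not_ge
    · exact sup_le hy.le (inf_eq_left.1 h)

theorem aux_least {α : Type u} [Lattice α] [Finite α] (h1 : JoinSemidistributive α)
    {m b : α} (hmb : m ⋖ b) :
    ∃ l : α, (m ⊔ l = b ∧ ∀ z, m ⊔ z = b → l ≤ z) ∧ l ⊓ m < l ∧ ∀ y, y < l → y ≤ l ⊓ m :=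
  aux_greatest (α := αᵒᵈ) (j := OrderDual.toDual m) (a := OrderDual.toDual b) h1 hmb.toDual

theorem aux_lower {α : Type u} [Lattice α] [Finite α] {j a z : α} (hj : JoinIrred j)
    (ha : a ⋖ j) (hz : z < j) : z ≤ a := by
  obtain ⟨c, hzc, hc⟩ := exists_le_covBy_of_lt hz
  rwa [hj.unique ha hc]

theorem aux_upper {α : Type u} [Lattice α] [Finite α] {m b z : α} (hm : MeetIrred m)
    (hb : m ⋖ b) (hz : m < z) : b ≤ z := by
  obtain ⟨c, hc, hzc⟩ := exists_covBy_le_of_lt hz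
  rwa [hm.unique hb hc]

/-- a finite semidistributive lattice has exactly one pairing. -/
theorem stmt4 {α : Type u} [Lattice α] [Finite α]
    (h1 : JoinSemidistributive α) (h2 : MeetSemidistributive α) :
    ∃! κ : {j : α // JoinIrred j} → {m : α // MeetIrred m}, IsPairing κ := by
  have key : ∀ j : {j : α // JoinIrred j}, ∃ m : {m : α // MeetIrred m}, ∃ a, a ⋖ j.1 ∧
      (j.1 ⊓ m.1 = a ∧ ∀ z, j.1 ⊓ z = a → z ≤ m.1) ∧ m.1 ⋖ m.1 ⊔ j.1 := by
    rintro ⟨j, hj⟩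
    obtain ⟨a, ha, hu⟩ := hj
    obtain ⟨k, hk, hlt, hall⟩ := aux_greatest h2 ha
    have hc : k ⋖ k ⊔ j := ⟨hlt, fun c hc hc' => (hall c hc).not_gt hc'⟩
    refine ⟨⟨k, k ⊔ j, hc, fun y hy => ?_⟩, a, ha, hk, hc⟩
    rcases hy.eq_or_eq hlt.le (hall y hy.lt) with h | h
    · exact absurd h hlt.ne'
    · exact h.symm
  choose κ A hA hκ hcov using key
  have hmin : ∀ j : {j : α // JoinIrred j}, ∀ z, z ≤ j.1 → (κ j).1 ⊔ z = (κ j).1 ⊔ j.1 →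
      j.1 ≤ z := by
    intro j z hz h
    rcases hz.lt_or_eq with hlt | heq
    · have hza : z ≤ A j := aux_lower j.2 (hA j) hlt
      have hzk : z ≤ (κ j).1 := hza.trans ((hκ j).1 ▸ inf_le_right)
      rw [sup_eq_left.2 hzk] at h
      exact absurd h (hcov j).lt.ne
    · exact heq.ge
  have hle : ∀ j j' : {j : α // JoinIrred j}, κ j = κ j' → j.1 ≤ j'.1 := by
    intro j j' h
    have e : (κ j).1 ⊔ j.1 = (κ j).1 ⊔ j'.1 :=
      (κ j).2.unique (hcov j) (by rw [h]; exact hcov j')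
    have := hmin j (j.1 ⊓ j'.1) inf_le_left (h1 _ _ _ e)
    exact this.trans inf_le_right
  refine ⟨κ, ⟨⟨fun j j' h => Subtype.ext (le_antisymm (hle j j' h) (hle j' j h.symm)), ?_⟩,
    ?_, ?_⟩, ?_⟩
  · rintro ⟨m, hm⟩
    obtain ⟨b, hb, -⟩ := id hm
    obtain ⟨l, hl, hlt, hall⟩ := aux_least h1 hb
    have hc : l ⊓ m ⋖ l := ⟨hlt, fun c hc hc' => (hall c hc').not_gt hc⟩
    have hlj : JoinIrred l := by
      refine ⟨l ⊓ m, hc, fun y hy => ?_⟩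
      rcases hy.eq_or_eq (hall y hy.lt) hlt.le with h | h
      · exact h.symm
      · exact absurd h hlt.ne
    refine ⟨⟨l, hlj⟩, Subtype.ext ?_⟩
    have hAe : l ⊓ m = A ⟨l, hlj⟩ := hlj.unique hc (hA ⟨l, hlj⟩)
    have hmk : m ≤ (κ ⟨l, hlj⟩).1 := (hκ ⟨l, hlj⟩).2 m hAe
    rcases hmk.lt_or_eq with h | h
    · have hbk := aux_upper hm hb h
      have hlk : l ≤ (κ ⟨l, hlj⟩).1 := (hl.1 ▸ le_sup_right : l ≤ b).trans hbk
      exact absurd (sup_eq_left.2 hlk) (hcov ⟨l, hlj⟩).lt.ne'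
    · exact h.symm
  · intro j a ha
    have e : a = A j := j.2.unique ha (hA j)
    subst e
    exact ⟨(hκ j).1, fun z hz _ => (hκ j).2 z hz⟩
  · intro j b hb
    have e : b = (κ j).1 ⊔ j.1 := (κ j).2.unique hb (hcov j)
    subst e
    exact ⟨rfl, fun z hz hzj => hmin j z hzj hz⟩
  · rintro κ' ⟨-, hmax, -⟩
    funext j
    have hM := hmax j (A j) (hA j)
    have hle' := (hκ j).2 _ hM.1
    exact Subtype.ext (le_antisymm hle' (hM.2 (hκ j).1 hle'))
end

section
/- Every finite extremal lattice is uniquely paired; that is, a finite extremal lattice has exactly one pairing. -/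
universe u

/-- A finite lattice is extremal if it has a maximum-length chain
`⊥ = x0 ⋖ x1 ⋖ ⋯ ⋖ xn = ⊤` such that `|J_L| = |M_L| = n`. -/
def Extremal (α : Type u) [Lattice α] [BoundedOrder α] : Prop :=
  ∃ (n : ℕ) (c : Fin (n + 1) → α),
    c 0 = ⊥ ∧ c (Fin.last n) = ⊤ ∧
    (∀ i : Fin n, c i.castSucc ⋖ c i.succ) ∧
    (∀ (m : ℕ) (d : Fin (m + 1) → α), StrictMono d → m ≤ n) ∧
    Nat.card {j : α // JoinIrred j} = n ∧
    Nat.card {m : α // MeetIrred m} = n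

theorem aux_exists_ji {α : Type u} [Lattice α] [BoundedOrder α] [Finite α] {x y : α}
    (h : ¬ y ≤ x) : ∃ j : {j : α // JoinIrred j}, j.1 ≤ y ∧ ¬ j.1 ≤ x := by
  obtain ⟨j, hj⟩ := Set.Finite.exists_minimal (Set.toFinite {j : α | j ≤ y ∧ ¬ j ≤ x})
    ⟨y, le_refl y, h⟩
  have hlt : ∀ z, z < j → z ≤ x := by
    intro z hz
    by_contra hzx
    exact absurd (hj.2 ⟨hz.le.trans hj.1.1, hzx⟩ hz.le) (not_le_of_gt hz)
  have hb : ⊥ < j := by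
    rw [bot_lt_iff_ne_bot]
    rintro rfl
    exact hj.1.2 bot_le
  obtain ⟨a, -, ha⟩ := exists_le_covBy_of_lt hb
  refine ⟨⟨j, a, ha, ?_⟩, hj.1⟩
  intro b hbj
  by_contra hne
  have : b ⊔ a = j := WCovBy.sup_eq (CovBy.wcovBy hbj) ha.wcovBy hne
  exact hj.1.2 (this ▸ sup_le (hlt b hbj.lt) (hlt a ha.lt))

theorem aux_exists_mi {α : Type u} [Lattice α] [BoundedOrder α] [Finite α] {x y : α}
    (h : ¬ y ≤ x) : ∃ m : {m : α // MeetIrred m}, x ≤ m.1 ∧ ¬ y ≤ m.1 := by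
  obtain ⟨j, hj⟩ := Set.Finite.exists_maximal (Set.toFinite {j : α | x ≤ j ∧ ¬ y ≤ j})
    ⟨x, le_refl x, h⟩
  have hlt : ∀ z, j < z → y ≤ z := by
    intro z hz
    by_contra hzx
    exact absurd (hj.2 ⟨hj.1.1.trans hz.le, hzx⟩ hz.le) (not_le_of_gt hz)
  have hb : j < ⊤ := by
    rw [lt_top_iff_ne_top]
    rintro rfl
    exact hj.1.2 le_top
  obtain ⟨a, ha, -⟩ := exists_covBy_le_of_lt hb
  refine ⟨⟨j, a, ha, ?_⟩, hj.1⟩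
  intro b hbj
  by_contra hne
  have : b ⊓ a = j := WCovBy.inf_eq (CovBy.wcovBy hbj) ha.wcovBy hne
  exact hj.1.2 (this ▸ le_inf (hlt b hbj.lt) (hlt a ha.lt))

theorem aux_ji {α : Type u} [Lattice α] [BoundedOrder α] [Finite α] {n : ℕ} (a b : Fin n → α)
    (hab : ∀ i, a i < b i) (hba : ∀ i k, i < k → b i ≤ a k)
    (hn : Nat.card {j : α // JoinIrred j} = n) :
    ∃ e : Fin n ≃ {j : α // JoinIrred j}, ∀ i, (e i).1 ≤ b i ∧ ¬ (e i).1 ≤ a i ∧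
      ∀ y, y < (e i).1 → y ≤ a i := by
  choose e he using fun i => aux_exists_ji (not_le_of_gt (hab i))
  have hlt : ∀ i k, i < k → (e i).1 ≤ a k := fun i k h => (he i).1.trans (hba i k h)
  have hinj : Function.Injective e := by
    intro i k h
    rcases lt_trichotomy i k with h1 | h1 | h1
    · exact absurd (h ▸ hlt i k h1) (he k).2
    · exact h1
    · exact absurd (h ▸ hlt k i h1) (he i).2
  have hbij : Function.Bijective e := by
    rw [Nat.bijective_iff_injective_and_card]
    exact ⟨hinj, by simp [hn]⟩
  refine ⟨Equiv.ofBijective e hbij, fun i => ⟨(he i).1, (he i).2, fun y hy => ?_⟩⟩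
  by_contra hc
  obtain ⟨j, hj, hj'⟩ := aux_exists_ji hc
  obtain ⟨k, rfl⟩ := hbij.2 j
  change y < (e i).1 at hy
  rcases lt_trichotomy i k with h1 | h1 | h1
  · exact (he k).2 (hj.trans (hy.le.trans (hlt i k h1)))
  · subst h1
    exact absurd hj (not_le_of_gt hy)
  · exact hj' (hlt k i h1)

theorem aux_mi {α : Type u} [Lattice α] [BoundedOrder α] [Finite α] {n : ℕ} (a b : Fin n → α)
    (hab : ∀ i, a i < b i) (hba : ∀ i k, i < k → b i ≤ a k)
    (hn : Nat.card {m : α // MeetIrred m} = n) :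
    ∃ f : Fin n ≃ {m : α // MeetIrred m}, ∀ i, a i ≤ (f i).1 ∧ ¬ b i ≤ (f i).1 ∧
      ∀ y, (f i).1 < y → b i ≤ y := by
  choose e he using fun i => aux_exists_mi (not_le_of_gt (hab i))
  have hlt : ∀ i k, i < k → b i ≤ (e k).1 := fun i k h => (hba i k h).trans (he k).1
  have hinj : Function.Injective e := by
    intro i k h
    rcases lt_trichotomy i k with h1 | h1 | h1
    · exact absurd (h ▸ hlt i k h1) (he i).2
    · exact h1
    · exact absurd (h ▸ hlt k i h1) (he k).2
  have hbij : Function.Bijective e := by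
    rw [Nat.bijective_iff_injective_and_card]
    exact ⟨hinj, by simp [hn]⟩
  refine ⟨Equiv.ofBijective e hbij, fun i => ⟨(he i).1, (he i).2, fun y hy => ?_⟩⟩
  by_contra hc
  obtain ⟨j, hj, hj'⟩ := aux_exists_mi hc
  obtain ⟨k, rfl⟩ := hbij.2 j
  change (e i).1 < y at hy
  rcases lt_trichotomy i k with h1 | h1 | h1
  · exact hj' (hlt i k h1)
  · subst h1
    exact absurd hj (not_le_of_gt hy)
  · exact (he k).2 ((hlt k i h1).trans (hy.le.trans hj))

/-- a finite extremal lattice has exactly one pairing. -/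
theorem stmt5 {α : Type u} [Lattice α] [BoundedOrder α] [Finite α]
    (h : Extremal α) :
    ∃! κ : {j : α // JoinIrred j} → {m : α // MeetIrred m}, IsPairing κ := by
  obtain ⟨n, c, -, -, hc, -, hJ, hM⟩ := h
  have hmono : StrictMono c := Fin.strictMono_iff_lt_succ.2 fun i => (hc i).lt
  have hba : ∀ i k : Fin n, i < k → c i.succ ≤ c k.castSucc := fun i k h =>
    hmono.monotone (Fin.le_def.2 (Nat.succ_le_of_lt (Fin.lt_def.1 h)))
  have hsup : ∀ (i : Fin n) (z : α), z ≤ c i.succ → ¬ z ≤ c i.castSucc →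
      c i.castSucc ⊔ z = c i.succ := by
    intro i z h1 h2
    rcases (hc i).eq_or_eq le_sup_left (sup_le (hc i).lt.le h1) with h3 | h3
    · exact absurd (h3 ▸ le_sup_right) h2
    · exact h3
  obtain ⟨e, he⟩ := aux_ji (fun i : Fin n => c i.castSucc) (fun i => c i.succ)
    (fun i => (hc i).lt) hba hJ
  obtain ⟨f, hf⟩ := aux_mi (fun i : Fin n => c i.castSucc) (fun i => c i.succ)
    (fun i => (hc i).lt) hba hM
  have hnle : ∀ i, ¬ (e i).1 ≤ (f i).1 := by
    intro i h
    apply (hf i).2.1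
    change c i.succ ≤ _
    rw [← hsup i _ (he i).1 (he i).2.1]
    exact sup_le (hf i).1 h
  refine ⟨fun j => f (e.symm j), ⟨(e.symm.trans f).bijective, ?_, ?_⟩, ?_⟩
  · intro j jst hj
    obtain ⟨i, rfl⟩ := e.surjective j
    simp only [Equiv.symm_apply_apply]
    constructor
    · have h1 : jst ≤ (e i).1 ⊓ (f i).1 := le_inf hj.lt.le (((he i).2.2 _ hj.lt).trans (hf i).1)
      rcases hj.eq_or_eq h1 inf_le_left with h2 | h2
      · exact h2
      · exact absurd (inf_eq_left.1 h2) (hnle i)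
    · intro z hz hle
      by_contra hn
      have h1 := (hf i).2.2 z (lt_of_le_not_ge hle hn)
      have h2 : (e i).1 ⊓ z = (e i).1 := inf_eq_left.2 ((he i).1.trans h1)
      exact hj.lt.ne (hz.symm.trans h2)
  · intro j mst hm
    obtain ⟨i, rfl⟩ := e.surjective j
    simp only [Equiv.symm_apply_apply] at hm ⊢
    constructor
    · have h1 : (f i).1 ⊔ (e i).1 ≤ mst := sup_le hm.lt.le ((he i).1.trans ((hf i).2.2 _ hm.lt))
      rcases hm.eq_or_eq le_sup_left h1 with h2 | h2
      · exact absurd (sup_eq_left.1 h2) (hnle i)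
      · exact h2
    · intro z hz hle
      by_contra hn
      have h1 := (he i).2.2 z (lt_of_le_not_ge hle hn)
      have h2 : (f i).1 ⊔ z = (f i).1 := sup_eq_left.2 (h1.trans (hf i).1)
      exact hm.lt.ne (h2.symm.trans hz)
  · intro κ hκ
    have hle : ∀ i, f.symm (κ (e i)) ≤ i := by
      intro i
      by_contra hlt
      obtain ⟨jst, hj, -⟩ := (e i).2
      have h1 := (hκ.2.1 (e i) jst hj).1
      have h2 : (e i).1 ≤ (κ (e i)).1 := by
        have h3 := (hf (f.symm (κ (e i)))).1
        rw [Equiv.apply_symm_apply] at h3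
        exact (he i).1.trans ((hba _ _ (not_le.1 hlt)).trans h3)
      exact hj.lt.ne (h1.symm.trans (inf_eq_left.2 h2))
    have hid : ∀ i, f.symm (κ (e i)) = i := by
      intro i
      induction i using WellFoundedLT.induction with
      | ind i ih =>
        rcases (hle i).lt_or_eq with h | h
        · exact e.injective (hκ.1.1 (f.symm.injective (ih _ h)))
        · exact h
    funext j
    obtain ⟨i, rfl⟩ := e.surjective j
    rw [Equiv.symm_apply_apply, ← Equiv.symm_apply_eq]
    exact hid i
end

section
/- Let L be a finite uniquely paired lattice with unique pairing κ_L. If j ∈ J_L is join-prime and j' ∈ J_L satisfies j ≠ j' and j ≰ κ_L(j'), then j' ≤ κ_L(j). (In the Galois graph G_L, there is no pair of opposite edges j → j' and j' → j through a join-prime vertex j.) -/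
universe u

/-- in a uniquely paired lattice, if `j` is join-prime and there is a Galois
edge `j → j'`, then there is no edge `j' → j`, i.e. `j' ≤ κ_L j`. -/
theorem stmt6 {α : Type u} [Lattice α] [Finite α]
    (κ : {j : α // JoinIrred j} → {m : α // MeetIrred m})
    (hκ : IsPairing κ) (huniq : ∀ κ', IsPairing κ' → κ' = κ)
    (j j' : {j : α // JoinIrred j}) (hjp : JoinPrime j.1)
    (hne : j ≠ j') (hedge : ¬ j.1 ≤ (κ j').1) :
    j'.1 ≤ (κ j).1 := by
  obtain ⟨-, hmax, -⟩ := hκ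
  obtain ⟨a, ha, -⟩ := j.2
  obtain ⟨b, hb, hbu⟩ := j'.2
  have hM := hmax j a ha
  have hM' := hmax j' b hb
  have e1 : j.1 ⊓ (κ j).1 = a := hM.1
  have e2 : j'.1 ⊓ (κ j').1 = b := hM'.1
  have hbk : b ≤ (κ j').1 := e2 ▸ inf_le_right
  by_contra h
  have hnj : ¬ j.1 ≤ (κ j).1 := fun hh => by
    rw [inf_eq_left.mpr hh] at e1
    exact ha.lt.ne e1.symm
  by_cases hle : j.1 ≤ j'.1
  · have hlt : j.1 < j'.1 := lt_of_le_of_ne hle (fun e => hne (Subtype.ext e))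
    obtain ⟨c, hc, hcj⟩ := exists_le_covBy_of_lt hlt
    exact hedge ((hc.trans (hbu c hcj).le).trans hbk)
  · have hn : ¬ j.1 ≤ (κ j).1 ⊔ j'.1 := fun hh => (hjp _ _ hh).elim hnj hle
    have hak : a ≤ (κ j).1 := e1 ▸ inf_le_right
    have h1 : a ≤ j.1 ⊓ ((κ j).1 ⊔ j'.1) := le_inf ha.le (hak.trans le_sup_left)
    have h2 : j.1 ⊓ ((κ j).1 ⊔ j'.1) = a := by
      rcases ha.eq_or_eq h1 inf_le_left with h3 | h3
      · exact h3
      · exact absurd (inf_eq_left.mp h3) hn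
    exact h (le_sup_right.trans (hM.2 h2 le_sup_left))
end

section
/- Every compatibly dismantlable lattice is overlapping; that is, if L is a finite compatibly dismantlable lattice with unique pairing κ_L, then for every cover relation x ⋖ y in L there is a unique join-irreducible element j with j ≤ y and κ_L(j) ≥ x. -/
universe u

/-- Compatibly dismantlable lattices: either a one-element lattice, or a uniquely paired
lattice with a prime pair `(j0, m0)` whose intervals `[j0, ⊤] = Set.Ici j0` and
`[⊥, m0] = Set.Iic m0` are compatibly dismantlable, together with the compatibility
conditions relating the unique pairings via `α j = j0 ⊔ j` and `β m = m0 ⊓ m`. -/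
inductive CompatiblyDismantlable : (β : Type u) → [Lattice β] → [Finite β] → Prop
  | singleton (β : Type u) [Lattice β] [Finite β] (h : Nat.card β = 1) :
      CompatiblyDismantlable β
  | step (β : Type u) [Lattice β] [Finite β]
      (κ : {j : β // JoinIrred j} → {m : β // MeetIrred m})
      (hκ : IsPairing κ) (huniq : ∀ κ', IsPairing κ' → κ' = κ)
      (j0 m0 : β) (hpp : IsPrimePair j0 m0)
      (hup : CompatiblyDismantlable ↥(Set.Ici j0))
      (hdn : CompatiblyDismantlable ↥(Set.Iic m0))
      (κup : {j : ↥(Set.Ici j0) // JoinIrred j} → {m : ↥(Set.Ici j0) // MeetIrred m})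
      (hκup : IsPairing κup) (hκupuniq : ∀ κ', IsPairing κ' → κ' = κup)
      (κdn : {j : ↥(Set.Iic m0) // JoinIrred j} → {m : ↥(Set.Iic m0) // MeetIrred m})
      (hκdn : IsPairing κdn) (hκdnuniq : ∀ κ', IsPairing κ' → κ' = κdn)
      (halpha : ∀ j : {j : β // JoinIrred j}, j0 ≤ (κ j).1 →
          ∃ hji : JoinIrred (⟨j0 ⊔ j.1, Set.mem_Ici.mpr le_sup_left⟩ : ↥(Set.Ici j0)),
            (κup ⟨⟨j0 ⊔ j.1, Set.mem_Ici.mpr le_sup_left⟩, hji⟩).1.1 = (κ j).1)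
      (halphainj : ∀ j j' : {j : β // JoinIrred j}, j0 ≤ (κ j).1 → j0 ≤ (κ j').1 →
          j0 ⊔ j.1 = j0 ⊔ j'.1 → j = j')
      (halphasurj : ∀ j' : {j : ↥(Set.Ici j0) // JoinIrred j},
          ∃ j : {j : β // JoinIrred j}, j0 ≤ (κ j).1 ∧ j0 ⊔ j.1 = j'.1.1)
      (hbeta : ∀ (j : {j : β // JoinIrred j}) (h : j.1 ≤ m0),
          ∃ hji : JoinIrred (⟨j.1, Set.mem_Iic.mpr h⟩ : ↥(Set.Iic m0)),
            (κdn ⟨⟨j.1, Set.mem_Iic.mpr h⟩, hji⟩).1.1 = m0 ⊓ (κ j).1)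
      (hbetainj : ∀ j j' : {j : β // JoinIrred j}, j.1 ≤ m0 → j'.1 ≤ m0 →
          m0 ⊓ (κ j).1 = m0 ⊓ (κ j').1 → j = j')
      (hbetasurj : ∀ m' : {m : ↥(Set.Iic m0) // MeetIrred m},
          ∃ j : {j : β // JoinIrred j}, j.1 ≤ m0 ∧ m0 ⊓ (κ j).1 = m'.1.1) :
      CompatiblyDismantlable β

/-- A lattice is semidistrim if it is compatibly dismantlable and the downward and upward
label sets of every element are independent sets of the Galois graph. -/
def Semidistrim (β : Type u) [Lattice β] [Finite β] : Prop :=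
  CompatiblyDismantlable β ∧
    ∀ κ : {j : β // JoinIrred j} → {m : β // MeetIrred m}, IsPairing κ →
      ∀ x : β, IndepSet κ (DLabel κ x) ∧ IndepSet κ (ULabel κ x)

theorem not_le_kappa {α : Type u} [Lattice α]
    (κ : {j : α // JoinIrred j} → {m : α // MeetIrred m})
    (hκ : IsPairing κ) (j : {j : α // JoinIrred j}) : ¬ j.1 ≤ (κ j).1 := by
  intro h
  obtain ⟨s, hs, -⟩ := j.2
  have h1 : j.1 ⊓ (κ j).1 = s := (hκ.2.1 j s hs).1
  rw [inf_eq_left.mpr h] at h1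
  exact hs.1.ne h1.symm

theorem lt_le_kappa {α : Type u} [Lattice α] [Finite α]
    (κ : {j : α // JoinIrred j} → {m : α // MeetIrred m})
    (hκ : IsPairing κ) (j : {j : α // JoinIrred j}) (z : α) (h : z < j.1) : z ≤ (κ j).1 := by
  obtain ⟨s, hs, hu⟩ := j.2
  have h1 : j.1 ⊓ (κ j).1 = s := (hκ.2.1 j s hs).1
  obtain ⟨c, hzc, hcj⟩ := exists_le_covBy_of_lt h
  have : c = s := hu c hcj
  subst this
  exact hzc.trans (h1 ▸ inf_le_right)

theorem primePair_kappa {α : Type u} [Lattice α] [Finite α]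
    (κ : {j : α // JoinIrred j} → {m : α // MeetIrred m})
    (hκ : IsPairing κ) (j0 m0 : α) (hpp : IsPrimePair j0 m0) :
    ∃ h : JoinIrred j0, (κ ⟨j0, h⟩).1 = m0 := by
  have hjm : ¬ j0 ≤ m0 := fun h => (hpp m0).2 ⟨le_rfl, h⟩
  have hc : j0 ⊓ m0 ⋖ j0 := by
    refine ⟨lt_of_le_of_ne inf_le_left (fun h => hjm (inf_eq_left.mp h)), ?_⟩
    intro c h1 h2
    rcases (hpp c).1 with h | h
    · exact h1.not_ge (le_inf h2.le h)
    · exact h2.not_ge h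
  have hj : JoinIrred j0 := by
    refine ⟨j0 ⊓ m0, hc, ?_⟩
    intro c h
    rcases (hpp c).1 with h' | h'
    · have h2 : c ≤ j0 ⊓ m0 := le_inf h.le h'
      by_contra hne
      exact h.2 (lt_of_le_of_ne h2 hne) hc.1
    · exact absurd h' h.1.not_ge
  refine ⟨hj, ?_⟩
  have hm := hκ.2.1 ⟨j0, hj⟩ _ hc
  have h1 : (κ ⟨j0, hj⟩).1 ≤ m0 :=
    ((hpp _).1).resolve_right (not_le_kappa κ hκ ⟨j0, hj⟩)
  exact le_antisymm h1 (hm.2 rfl h1)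

/-- every compatibly dismantlable lattice is overlapping. -/
theorem stmt8 {α : Type u} [Lattice α] [Finite α]
    (hcd : CompatiblyDismantlable α)
    (κ : {j : α // JoinIrred j} → {m : α // MeetIrred m})
    (hκ : IsPairing κ) (huniq : ∀ κ', IsPairing κ' → κ' = κ) :
    Overlapping κ := by
  induction hcd with
  | singleton β h =>
    intro x y hxy
    have := (Nat.card_eq_one_iff_unique.mp h).1
    exact absurd (Subsingleton.elim x y) hxy.1.ne
  | step β κ1 hκ1 huniq1 j0 m0 hpp hup hdn κup hκup hκupuniq κdn hκdn hκdnuniq halpha halphainj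
      halphasurj hbeta hbetainj hbetasurj ihup ihdn =>
    obtain rfl := huniq1 κ hκ
    have oup := ihup κup hκup hκupuniq
    have odn := ihdn κdn hκdn hκdnuniq
    intro x y hxy
    by_cases hx : j0 ≤ x
    · have hy : j0 ≤ y := hx.trans hxy.le
      have hc : (⟨x, hx⟩ : ↥(Set.Ici j0)) ⋖ ⟨y, hy⟩ :=
        ⟨hxy.1, fun c h1 h2 => hxy.2 (c := c.1) h1 h2⟩
      obtain ⟨j', ⟨hj1, hj2⟩, hu⟩ := oup _ _ hc
      obtain ⟨j, hj, hje⟩ := halphasurj j'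
      refine ⟨j, ⟨?_, ?_⟩, ?_⟩
      · exact (le_sup_right.trans hje.le).trans hj1
      · obtain ⟨hji, he⟩ := halpha j hj
        rw [← he]
        have : (⟨⟨j0 ⊔ j.1, Set.mem_Ici.mpr le_sup_left⟩, hji⟩ :
          {j : ↥(Set.Ici j0) // JoinIrred j}) = j' := Subtype.ext (Subtype.ext hje)
        rw [this]
        exact hj2
      · rintro i ⟨hi1, hi2⟩
        have hi := hx.trans hi2
        obtain ⟨hji, he⟩ := halpha i hi
        apply halphainj _ _ hi hj
        have := hu ⟨⟨j0 ⊔ i.1, Set.mem_Ici.mpr le_sup_left⟩, hji⟩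
          ⟨sup_le hy hi1, show x ≤ _ from he ▸ hi2⟩
        rw [hje, ← this]
    · have hx' : x ≤ m0 := ((hpp x).1).resolve_right hx
      by_cases hy : y ≤ m0
      · have hc : (⟨x, hx'⟩ : ↥(Set.Iic m0)) ⋖ ⟨y, hy⟩ :=
          ⟨hxy.1, fun c h1 h2 => hxy.2 (c := c.1) h1 h2⟩
        obtain ⟨j', ⟨hj1, hj2⟩, hu⟩ := odn _ _ hc
        obtain ⟨j, hj, hje⟩ := hbetasurj (κdn j')
        obtain ⟨hji, he⟩ := hbeta j hj
        have hjj := hκdn.1.1 (Subtype.ext (Subtype.ext (he.trans hje)))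
        refine ⟨j, ⟨?_, ?_⟩, ?_⟩
        · rw [← hjj] at hj1
          exact hj1
        · have : x ≤ (κdn j').1.1 := hj2
          rw [← hje] at this
          exact this.trans inf_le_right
        · rintro i ⟨hi1, hi2⟩
          have hi := hi1.trans hy
          obtain ⟨hji', he'⟩ := hbeta i hi
          have := hu ⟨⟨i.1, Set.mem_Iic.mpr hi⟩, hji'⟩
            ⟨hi1, show x ≤ _ from he' ▸ le_inf hx' hi2⟩
          rw [← hjj] at this
          exact Subtype.ext (congrArg (fun t => t.1.1) this)
      · have hy' : j0 ≤ y := ((hpp y).1).resolve_left hy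
        obtain ⟨hj0, hk⟩ := primePair_kappa κ hκ j0 m0 hpp
        refine ⟨⟨j0, hj0⟩, ⟨hy', hk ▸ hx'⟩, ?_⟩
        rintro i ⟨hi1, hi2⟩
        have hn := not_le_kappa κ hκ i
        have h1 : j0 ≤ i.1 := by
          refine ((hpp i.1).1).resolve_left fun h => ?_
          have hlt : x < x ⊔ i.1 := lt_of_le_of_ne le_sup_left fun h' =>
            hn ((le_sup_right.trans h'.ge).trans hi2)
          have hlt2 : x ⊔ i.1 < y := lt_of_le_of_ne (sup_le hxy.le hi1) fun h' =>
            hy (h' ▸ sup_le hx' h)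
          exact hxy.2 hlt hlt2
        have h2 : (κ i).1 ≤ m0 := by
          refine ((hpp (κ i).1).1).resolve_right fun h => ?_
          have hlt : y ⊓ (κ i).1 < y := lt_of_le_of_ne inf_le_left fun h' =>
            hn (hi1.trans (inf_eq_left.mp h'))
          have hlt2 : x < y ⊓ (κ i).1 := lt_of_le_of_ne (le_inf hxy.le hi2) fun h' =>
            hx (h' ▸ le_inf hy' h)
          exact hxy.2 hlt2 hlt
        apply Subtype.ext
        by_contra hne
        have := lt_le_kappa κ hκ i j0 (lt_of_le_of_ne h1 (Ne.symm hne))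
        exact (hpp j0).2 ⟨this.trans h2, le_rfl⟩
end

section
/- Let L be a finite compatibly dismantlable lattice with unique pairing κ_L. Every element x ∈ L satisfies x = ⋁ D_L(x) and x = ⋀ κ_L(U_L(x)), where D_L(x) and U_L(x) are the downward and upward label sets of x. In particular, every element of L is uniquely determined by its downward label set, and also by its upward label set. -/
universe u

theorem pairing_not_le {β : Type u} [Lattice β]
    (κ : {j : β // JoinIrred j} → {m : β // MeetIrred m}) (hκ : IsPairing κ)
    (j : {j : β // JoinIrred j}) : ¬ j.1 ≤ (κ j).1 := by
  intro h
  obtain ⟨y, hy, -⟩ := j.2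
  have h1 : j.1 ⊓ (κ j).1 = y := (hκ.2.1 j y hy).1
  rw [inf_eq_left.mpr h] at h1
  exact hy.lt.ne h1.symm

theorem exists_label {β : Type u} [Lattice β] [Finite β] (hcd : CompatiblyDismantlable β) :
    ∀ (κ : {j : β // JoinIrred j} → {m : β // MeetIrred m}), IsPairing κ →
      ∀ x y : β, x ⋖ y → ∃ j : {j : β // JoinIrred j}, j.1 ≤ y ∧ x ≤ (κ j).1 := by
  induction hcd with
  | singleton β h =>
    intro κ _ x y hxy
    have := (Nat.card_eq_one_iff_unique.mp h).1
    exact absurd (Subsingleton.elim x y) hxy.lt.ne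
  | step β κ hκ huniq j0 m0 hpp hup hdn κup hκup hκupuniq κdn hκdn hκdnuniq halpha halphainj
      halphasurj hbeta hbetainj hbetasurj ihup ihdn =>
    intro κ' hκ' x y hxy
    obtain rfl := huniq κ' hκ'
    by_cases hx : j0 ≤ x
    · have hy : j0 ≤ y := hx.trans hxy.le
      have hc : (⟨x, hx⟩ : ↥(Set.Ici j0)) ⋖ ⟨y, hy⟩ :=
        ⟨hxy.lt, fun c h1 h2 => hxy.2 (c := c.1) h1 h2⟩
      obtain ⟨j', h1, h2⟩ := ihup κup hκup _ _ hc
      obtain ⟨j, hj, hjj⟩ := halphasurj j'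
      obtain ⟨hji, he⟩ := halpha j hj
      have e : (⟨⟨j0 ⊔ j.1, Set.mem_Ici.mpr le_sup_left⟩, hji⟩ :
          {j : ↥(Set.Ici j0) // JoinIrred j}) = j' := Subtype.ext (Subtype.ext hjj)
      rw [e] at he
      have h1' : j'.1.1 ≤ y := h1
      have h2' : x ≤ (κup j').1.1 := h2
      exact ⟨j, le_sup_right.trans (hjj.le.trans h1'), he ▸ h2'⟩
    have hx' : x ≤ m0 := (hpp x).1.resolve_right hx
    by_cases hy : y ≤ m0
    · have hc : (⟨x, hx'⟩ : ↥(Set.Iic m0)) ⋖ ⟨y, hy⟩ :=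
        ⟨hxy.lt, fun c h1 h2 => hxy.2 (c := c.1) h1 h2⟩
      obtain ⟨j', h1, h2⟩ := ihdn κdn hκdn _ _ hc
      obtain ⟨j, hj, hjj⟩ := hbetasurj (κdn j')
      obtain ⟨hji, he⟩ := hbeta j hj
      have e := hκdn.1.1 (Subtype.ext (Subtype.ext (he.trans hjj)))
      have h1' : j'.1.1 ≤ y := h1
      have h2' : x ≤ (κdn j').1.1 := h2
      rw [← hjj] at h2'
      rw [← e] at h1'
      exact ⟨j, h1', h2'.trans inf_le_right⟩
    have hy' : j0 ≤ y := (hpp y).1.resolve_left hy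
    have hlt : ∀ z, z < j0 → z ≤ j0 ⊓ m0 := fun z hz =>
      le_inf hz.le ((hpp z).1.resolve_right hz.not_ge)
    have hs : j0 ⊓ m0 < j0 := lt_of_le_of_ne inf_le_left fun h =>
      (hpp j0).2 ⟨inf_eq_left.mp h, le_rfl⟩
    have hcov : j0 ⊓ m0 ⋖ j0 := ⟨hs, fun c h1 h2 => (h1.trans_le (hlt c h2)).false⟩
    have hJ : JoinIrred j0 := ⟨j0 ⊓ m0, hcov, fun z hz =>
      (hlt z hz.lt).eq_of_not_lt fun h => hz.2 h hs⟩
    have hm := hκ.2.1 ⟨j0, hJ⟩ _ hcov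
    have hk : (κ' ⟨j0, hJ⟩).1 ≤ m0 :=
      (hpp _).1.resolve_right fun h => pairing_not_le κ' hκ ⟨j0, hJ⟩ h
    exact ⟨⟨j0, hJ⟩, hy', hx'.trans (hm.2 rfl hk)⟩

/-- in a compatibly dismantlable lattice, `x = ⋁ D_L(x) = ⋀ κ_L(U_L(x))`;
in particular each element is determined by its downward label set and by its upward
label set. -/
theorem stmt9 {α : Type u} [CompleteLattice α] [Finite α]
    (hcd : CompatiblyDismantlable α)
    (κ : {j : α // JoinIrred j} → {m : α // MeetIrred m})
    (hκ : IsPairing κ) (huniq : ∀ κ', IsPairing κ' → κ' = κ) :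
    (∀ x : α, x = sSup ((fun j : {j : α // JoinIrred j} => j.1) '' DLabel κ x)) ∧
    (∀ x : α, x = sInf ((fun j : {j : α // JoinIrred j} => (κ j).1) '' ULabel κ x)) ∧
    (∀ x y : α, DLabel κ x = DLabel κ y → x = y) ∧
    (∀ x y : α, ULabel κ x = ULabel κ y → x = y) := by
  have key := exists_label hcd κ hκ
  have hD : ∀ x : α, x = sSup ((fun j : {j : α // JoinIrred j} => j.1) '' DLabel κ x) := by
    intro x
    by_contra hne
    have hle : sSup ((fun j : {j : α // JoinIrred j} => j.1) '' DLabel κ x) ≤ x := by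
      apply sSup_le
      rintro _ ⟨j, ⟨y, -, h, -⟩, rfl⟩
      exact h
    obtain ⟨y, hy1, hy2⟩ := exists_le_covBy_of_lt (lt_of_le_of_ne hle (Ne.symm hne))
    obtain ⟨j, hj1, hj2⟩ := key y x hy2
    exact pairing_not_le κ hκ j
      ((le_sSup (Set.mem_image_of_mem (fun j : {j : α // JoinIrred j} => j.1)
        (show j ∈ DLabel κ x from ⟨y, hy2, hj1, hj2⟩))).trans (hy1.trans hj2))
  have hU : ∀ x : α, x = sInf ((fun j : {j : α // JoinIrred j} => (κ j).1) '' ULabel κ x) := by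
    intro x
    by_contra hne
    have hle : x ≤ sInf ((fun j : {j : α // JoinIrred j} => (κ j).1) '' ULabel κ x) := by
      apply le_sInf
      rintro _ ⟨j, ⟨y, -, -, h⟩, rfl⟩
      exact h
    obtain ⟨y, hy1, hy2⟩ := exists_covBy_le_of_lt (lt_of_le_of_ne hle hne)
    obtain ⟨j, hj1, hj2⟩ := key x y hy1
    exact pairing_not_le κ hκ j (hj1.trans (hy2.trans
      (sInf_le (Set.mem_image_of_mem (fun j : {j : α // JoinIrred j} => (κ j).1)
        (show j ∈ ULabel κ x from ⟨y, hy1, hj1, hj2⟩)))))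
  refine ⟨hD, hU, fun x y h => ?_, fun x y h => ?_⟩
  · rw [hD x, h, ← hD y]
  · rw [hU x, h, ← hU y]
end

section
/- Every finite trim lattice is semidistrim. -/
universe u

/-- An element `x` is left modular if `(y ⊔ x) ⊓ z = y ⊔ (x ⊓ z)` whenever `y ≤ z`. -/
def LeftModular {α : Type u} [Lattice α] (x : α) : Prop :=
  ∀ y z : α, y ≤ z → (y ⊔ x) ⊓ z = y ⊔ (x ⊓ z)

/-- A lattice is trim if it is extremal and has a maximal chain of left modular elements. -/
def Trim (α : Type u) [Lattice α] [BoundedOrder α] : Prop :=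
  Extremal α ∧
    ∃ (n : ℕ) (c : Fin (n + 1) → α),
      c 0 = ⊥ ∧ c (Fin.last n) = ⊤ ∧
      (∀ i : Fin n, c i.castSucc ⋖ c i.succ) ∧
      (∀ i : Fin (n + 1), LeftModular (c i))

section helpers

theorem ji_le {α : Type u} [Lattice α] [Finite α] {a b c : α} (ha : JoinIrred a) (hb : b ⋖ a)
    (hc : c < a) : c ≤ b := by
  obtain ⟨w, hw, hwa⟩ := exists_le_covBy_of_lt hc
  rw [ha.unique hb hwa]; exact hw

theorem mi_le {α : Type u} [Lattice α] [Finite α] {a b c : α} (ha : MeetIrred a) (hb : a ⋖ b)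
    (hc : a < c) : b ≤ c := by
  obtain ⟨w, hw, hwa⟩ := exists_covBy_le_of_lt hc
  rw [ha.unique hb hw]; exact hwa

theorem exists_mi {α : Type u} [Lattice α] [Finite α] {a b : α} (h : ¬ a ≤ b) :
    ∃ q, MeetIrred q ∧ b ≤ q ∧ ¬ a ≤ q := by
  obtain ⟨q, hq⟩ := (Set.toFinite {q : α | b ≤ q ∧ ¬ a ≤ q}).exists_maximal ⟨b, le_rfl, h⟩
  have key : ∀ w, q < w → a ≤ w := by
    intro w hw
    by_contra hn
    exact hw.not_ge (hq.2 ⟨hq.1.1.trans hw.le, hn⟩ hw.le)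
  have hlt : q < a ⊔ q := lt_of_le_of_ne le_sup_right
    (fun e => hq.1.2 (by rw [e]; exact le_sup_left))
  refine ⟨q, ⟨a ⊔ q, ⟨hlt, ?_⟩, ?_⟩, hq.1.1, hq.1.2⟩
  · intro c hc hc2
    exact hc2.not_ge (sup_le (key c hc) hc.le)
  · intro y hy
    have h1 : a ⊔ q ≤ y := sup_le (key y hy.lt) hy.le
    rcases h1.eq_or_lt with e | l
    · exact e.symm
    · exact absurd l (hy.2 hlt)

theorem exists_ji {α : Type u} [Lattice α] [Finite α] {a b : α} (h : ¬ b ≤ a) :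
    ∃ q, JoinIrred q ∧ q ≤ b ∧ ¬ q ≤ a := by
  obtain ⟨q, hq⟩ := (Set.toFinite {q : α | q ≤ b ∧ ¬ q ≤ a}).exists_minimal ⟨b, le_rfl, h⟩
  have key : ∀ w, w < q → w ≤ a := by
    intro w hw
    by_contra hn
    exact hw.not_ge (hq.2 ⟨hw.le.trans hq.1.1, hn⟩ hw.le)
  have hlt : a ⊓ q < q := lt_of_le_of_ne inf_le_right
    (fun e => hq.1.2 (by rw [← e]; exact inf_le_left))
  refine ⟨q, ⟨a ⊓ q, ⟨hlt, ?_⟩, ?_⟩, hq.1.1, hq.1.2⟩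
  · intro c hc hc2
    exact hc.not_ge (le_inf (key c hc2) hc2.le)
  · intro y hy
    have h1 : y ≤ a ⊓ q := le_inf (key y hy.lt) hy.le
    rcases h1.eq_or_lt with e | l
    · exact e
    · exact absurd hlt (hy.2 l)

/-- Overlapping extremal data. -/
structure TD (α : Type u) [Lattice α] (ι : Type) [LinearOrder ι] (j m : ι → α) : Prop where
  jirr : ∀ i, JoinIrred (j i)
  mirr : ∀ i, MeetIrred (m i)
  jsurj : ∀ a, JoinIrred a → ∃ i, j i = a
  msurj : ∀ a, MeetIrred a → ∃ i, m i = a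
  acyc : ∀ i k, i < k → j i ≤ m k
  diag : ∀ i, ¬ j i ≤ m i
  ex : ∀ y z, y ⋖ z → ∃ i, j i ≤ z ∧ y ≤ m i
  uniq : ∀ y z, y ⋖ z → ∀ i k, j i ≤ z → y ≤ m i → j k ≤ z → y ≤ m k → i = k

namespace TD

variable {α : Type u} [Lattice α] [Finite α] {ι : Type} [LinearOrder ι] [Finite ι] {j m : ι → α}

theorem jinj (T : TD α ι j m) {i k : ι} (h : j i = j k) : i = k := by
  rcases lt_trichotomy i k with l | l | l
  · exact absurd (h ▸ T.acyc _ _ l) (T.diag k)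
  · exact l
  · exact absurd (h ▸ T.acyc _ _ l) (T.diag i)

theorem minj (T : TD α ι j m) {i k : ι} (h : m i = m k) : i = k := by
  rcases lt_trichotomy i k with l | l | l
  · exact absurd (h ▸ T.acyc _ _ l) (T.diag i)
  · exact l
  · exact absurd (h ▸ T.acyc _ _ l) (T.diag k)

theorem lab (T : TD α ι j m) {y z : α} (h : y < z) : ∃ i, j i ≤ z ∧ y ≤ m i := by
  obtain ⟨w, hw, hwz⟩ := exists_covBy_le_of_lt h
  obtain ⟨i, h1, h2⟩ := T.ex _ _ hw
  exact ⟨i, h1.trans hwz, h2⟩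

theorem jst_le (T : TD α ι j m) {i : ι} {w : α} (h : w ⋖ j i) : w ≤ m i := by
  obtain ⟨s, h1, h2⟩ := T.ex _ _ h
  by_cases e : s = i
  · exact e ▸ h2
  · have : j s < j i := lt_of_le_of_ne h1 (fun e' => e (T.jinj e'))
    exact absurd ((ji_le (T.jirr i) h this).trans h2) (T.diag s)

theorem le_mst (T : TD α ι j m) {i : ι} {w : α} (h : m i ⋖ w) : j i ≤ w := by
  obtain ⟨s, h1, h2⟩ := T.ex _ _ h
  by_cases e : s = i
  · exact e ▸ h1
  · have : m i < m s := lt_of_le_of_ne h2 (fun e' => e (T.minj e').symm)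
    exact absurd (h1.trans (mi_le (T.mirr i) h this)) (T.diag s)

theorem pairing (T : TD α ι j m) :
    ∃ κ : {j : α // JoinIrred j} → {m : α // MeetIrred m}, IsPairing κ ∧
      (∀ κ', IsPairing κ' → κ' = κ) ∧ ∀ i, κ ⟨j i, T.jirr i⟩ = ⟨m i, T.mirr i⟩ := by
  choose f hf using fun a : {j : α // JoinIrred j} => T.jsurj a.1 a.2
  have hfj : ∀ i, f ⟨j i, T.jirr i⟩ = i := fun i => T.jinj (hf _)
  refine ⟨fun a => ⟨m (f a), T.mirr _⟩, ⟨⟨?_, ?_⟩, ?_, ?_⟩, ?_, ?_⟩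
  · intro a b h
    have := T.minj (Subtype.ext_iff.1 h)
    apply Subtype.ext
    rw [← hf a, ← hf b, this]
  · rintro ⟨b, hb⟩
    obtain ⟨i, rfl⟩ := T.msurj b hb
    exact ⟨⟨j i, T.jirr i⟩, by simp [hfj]⟩
  · rintro ⟨a, ha⟩ w hw
    obtain ⟨i, rfl⟩ := T.jsurj a ha
    simp only [hfj]
    simp only at hw
    have h1 := T.jst_le hw
    refine ⟨le_antisymm ?_ (le_inf hw.le h1), ?_⟩
    · apply ji_le ha hw
      exact lt_of_le_of_ne inf_le_left (fun e => T.diag i (by rw [← e]; exact inf_le_right))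
    · intro z hz hmz
      by_contra hn
      obtain ⟨v, hv, hvz⟩ := exists_covBy_le_of_lt (lt_of_le_not_ge hmz hn)
      have : j i ≤ z := (T.le_mst hv).trans hvz
      simp only [inf_eq_left.2 this] at hz
      exact hw.lt.ne hz.symm
  · rintro ⟨a, ha⟩ w hw
    obtain ⟨i, rfl⟩ := T.jsurj a ha
    simp only [hfj] at hw ⊢
    have h1 := T.le_mst hw
    refine ⟨le_antisymm (sup_le hw.le h1) ?_, ?_⟩
    · apply mi_le (T.mirr i) hw
      exact lt_of_le_of_ne le_sup_left (fun e => T.diag i (by rw [e]; exact le_sup_right))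
    · intro z hz hmz
      by_contra hn
      obtain ⟨v, hv, hvz⟩ := exists_le_covBy_of_lt (lt_of_le_not_ge hmz hn)
      have : z ≤ m i := hv.trans (T.jst_le hvz)
      simp only [sup_eq_left.2 this] at hz
      exact hw.lt.ne hz
  · intro κ' hκ
    choose g hg using fun i : ι => T.msurj (κ' ⟨j i, T.jirr i⟩).1 (κ' ⟨j i, T.jirr i⟩).2
    have ginj : ∀ i k, g i = g k → i = k := by
      intro i k h
      have h2 : κ' ⟨j i, T.jirr i⟩ = κ' ⟨j k, T.jirr k⟩ := by
        apply Subtype.ext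
        rw [← hg, ← hg, h]
      exact T.jinj (Subtype.ext_iff.1 (hκ.1.1 h2))
    have gle : ∀ i, g i ≤ i := by
      intro i
      by_contra hn
      have h1 := T.acyc _ _ (not_le.1 hn)
      obtain ⟨w, hw, -⟩ := T.jirr i
      have h2 := (hκ.2.1 ⟨j i, T.jirr i⟩ w hw).1
      simp only at h2 hw
      rw [← hg, inf_eq_left.2 h1] at h2
      exact hw.lt.ne h2.symm
    have gid : ∀ i, g i = i := by
      intro i
      induction i using (wellFounded_lt (α := ι)).induction with
      | _ i ih =>
        rcases (gle i).eq_or_lt with e | l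
        · exact e
        · exact ginj _ _ (ih _ l)
    funext a
    obtain ⟨a, ha⟩ := a
    obtain ⟨i, rfl⟩ := T.jsurj a ha
    apply Subtype.ext
    rw [← hg]
    simp [gid, hfj]
  · intro i
    simp [hfj]

theorem dn_aux (T : TD α ι j m) {x y z : α} (hy : y ⋖ x) (hzy : z ≤ y) {i t : ι}
    (hi : j i ≤ x) (hi' : y ≤ m i) (ht : j t ≤ x) (ht' : z ≤ m t)
    (hmax : ∀ s, j s ≤ x → z ≤ m s → s ≤ t) (hne : i ≠ t) : j t ≤ y := by
  have hlt : y ⊓ m t < y := lt_of_le_of_ne inf_le_left (fun e =>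
    hne (T.uniq _ _ hy _ _ hi hi' ht (by rw [← e]; exact inf_le_right)))
  obtain ⟨s, h1, h2⟩ := T.lab hlt
  rcases (hmax s (h1.trans hy.le) ((le_inf hzy ht').trans h2)).eq_or_lt with e | l
  · exact e ▸ h1
  · exact absurd ((le_inf h1 (T.acyc _ _ l)).trans h2) (T.diag s)

theorem up_aux (T : TD α ι j m) {x y z : α} (hy : x ⋖ y) (hzy : y ≤ z) {i t : ι}
    (hi : j i ≤ y) (hi' : x ≤ m i) (ht : j t ≤ z) (ht' : x ≤ m t)
    (hmin : ∀ s, j s ≤ z → x ≤ m s → t ≤ s) (hne : i ≠ t) : y ≤ m t := by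
  have hlt : y < y ⊔ j t := lt_of_le_of_ne le_sup_left (fun e =>
    hne (T.uniq _ _ hy _ _ hi hi' (by rw [e]; exact le_sup_right) ht'))
  obtain ⟨s, h1, h2⟩ := T.lab hlt
  rcases (hmin s (h1.trans (sup_le hzy ht)) (hy.le.trans h2)).eq_or_lt with e | l
  · exact e ▸ h2
  · exact absurd (h1.trans (sup_le h2 (T.acyc _ _ l))) (T.diag s)

theorem indepD (T : TD α ι j m) {x y y' : α} (hy : y ⋖ x) (hy' : y' ⋖ x) {i k : ι}
    (hi : j i ≤ x) (hi' : y ≤ m i) (hk : j k ≤ x) (hk' : y' ≤ m k) (hik : i < k) :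
    j k ≤ m i := by
  obtain ⟨t, ht⟩ := (Set.toFinite {s | j s ≤ x ∧ y ⊓ y' ≤ m s}).exists_maximal
    ⟨i, hi, inf_le_left.trans hi'⟩
  have hmax : ∀ s, j s ≤ x → y ⊓ y' ≤ m s → s ≤ t := by
    intro s h1 h2
    rcases le_total s t with l | l
    · exact l
    · exact ht.2 ⟨h1, h2⟩ l
  have hkt : k ≤ t := hmax k hk (inf_le_right.trans hk')
  have h1 : j t ≤ y := T.dn_aux hy inf_le_left hi hi' ht.1.1 ht.1.2 hmax (hik.trans_le hkt).ne
  by_cases e : k = t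
  · subst e; exact h1.trans hi'
  · have h2 : j t ≤ y' := T.dn_aux hy' inf_le_right hk hk' ht.1.1 ht.1.2 hmax e
    exact absurd ((le_inf h1 h2).trans ht.1.2) (T.diag t)

theorem indepU (T : TD α ι j m) {x y y' : α} (hy : x ⋖ y) (hy' : x ⋖ y') {i k : ι}
    (hi : j i ≤ y) (hi' : x ≤ m i) (hk : j k ≤ y') (hk' : x ≤ m k) (hik : i < k) :
    j k ≤ m i := by
  obtain ⟨t, ht⟩ := (Set.toFinite {s | j s ≤ y ⊔ y' ∧ x ≤ m s}).exists_minimal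
    ⟨i, hi.trans le_sup_left, hi'⟩
  have hmin : ∀ s, j s ≤ y ⊔ y' → x ≤ m s → t ≤ s := by
    intro s h1 h2
    rcases le_total t s with l | l
    · exact l
    · exact ht.2 ⟨h1, h2⟩ l
  have hit : t ≤ i := hmin i (hi.trans le_sup_left) hi'
  have h1 : y' ≤ m t := T.up_aux hy' le_sup_right hk hk' ht.1.1 ht.1.2 hmin (hit.trans_lt hik).ne'
  by_cases e : i = t
  · subst e; exact hk.trans h1
  · have h2 : y ≤ m t := T.up_aux hy le_sup_left hi hi' ht.1.1 ht.1.2 hmin e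
    exact absurd (ht.1.1.trans (sup_le h2 h1)) (T.diag t)

theorem coe_covBy_Iic {a : α} {y z : Set.Iic a} : y ⋖ z ↔ y.1 ⋖ z.1 := by
  constructor
  · rintro ⟨h1, h2⟩
    exact ⟨h1, fun c hc hc' => h2 (c := ⟨c, hc'.le.trans z.2⟩) hc hc'⟩
  · rintro ⟨h1, h2⟩
    exact ⟨h1, fun c hc hc' => h2 (c := c.1) hc hc'⟩

theorem coe_covBy_Ici {a : α} {y z : Set.Ici a} : y ⋖ z ↔ y.1 ⋖ z.1 := by
  constructor
  · rintro ⟨h1, h2⟩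
    exact ⟨h1, fun c hc hc' => h2 (c := ⟨c, le_trans y.2 hc.le⟩) hc hc'⟩
  · rintro ⟨h1, h2⟩
    exact ⟨h1, fun c hc hc' => h2 (c := c.1) hc hc'⟩

theorem ji_Iic {a : α} {y : Set.Iic a} : JoinIrred y ↔ JoinIrred y.1 := by
  constructor
  · rintro ⟨w, h1, h2⟩
    refine ⟨w.1, coe_covBy_Iic.1 h1, fun v hv => ?_⟩
    exact Subtype.ext_iff.1 (h2 ⟨v, hv.le.trans y.2⟩ (coe_covBy_Iic.2 hv))
  · rintro ⟨w, h1, h2⟩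
    refine ⟨⟨w, h1.le.trans y.2⟩, coe_covBy_Iic.2 h1, fun v hv => ?_⟩
    exact Subtype.ext (h2 v.1 (coe_covBy_Iic.1 hv))

theorem mi_Ici {a : α} {y : Set.Ici a} : MeetIrred y ↔ MeetIrred y.1 := by
  constructor
  · rintro ⟨w, h1, h2⟩
    refine ⟨w.1, coe_covBy_Ici.1 h1, fun v hv => ?_⟩
    exact Subtype.ext_iff.1 (h2 ⟨v, le_trans y.2 hv.le⟩ (coe_covBy_Ici.2 hv))
  · rintro ⟨w, h1, h2⟩
    refine ⟨⟨w, le_trans y.2 h1.le⟩, coe_covBy_Ici.2 h1, fun v hv => ?_⟩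
    exact Subtype.ext (h2 v.1 (coe_covBy_Ici.1 hv))

theorem iic (T : TD α ι j m) (a : α) :
    TD (Set.Iic a) {s : ι // j s ≤ a} (fun s => ⟨j s.1, s.2⟩)
      (fun s => ⟨a ⊓ m s.1, inf_le_left⟩) := by
  have hms : ∀ q : Set.Iic a, MeetIrred q → ∃ u : {s : ι // j s ≤ a}, q.1 = a ⊓ m u.1 := by
    intro q hq
    obtain ⟨w, hw, -⟩ := id hq
    obtain ⟨s, h1, h2⟩ := T.ex _ _ (coe_covBy_Iic.1 hw)
    refine ⟨⟨s, h1.trans w.2⟩, ?_⟩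
    have hle : q ≤ ⟨a ⊓ m s, inf_le_left⟩ := le_inf q.2 h2
    rcases hle.eq_or_lt with e | l
    · exact Subtype.ext_iff.1 e
    · have h5 := mi_le hq hw l
      have : w.1 ≤ a ⊓ m s := h5
      exact absurd (h1.trans (this.trans inf_le_right)) (T.diag s)
  refine ⟨fun i => ji_Iic.2 (T.jirr _), ?_, ?_, ?_, ?_, ?_, ?_, ?_⟩
  · rintro ⟨s, hs⟩
    have hn : ¬ ((⟨j s, hs⟩ : Set.Iic a) ≤ ⟨a ⊓ m s, inf_le_left⟩) :=
      fun h => T.diag s (le_trans (show j s ≤ a ⊓ m s from h) inf_le_right)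
    obtain ⟨q, hq, h1, h2⟩ := exists_mi hn
    obtain ⟨⟨u, hu⟩, hqu⟩ := hms q hq
    have h1' : a ⊓ m s ≤ q.1 := h1
    have h2' : ¬ j s ≤ q.1 := h2
    rw [hqu] at h1' h2'
    have e : u = s := by
      rcases lt_trichotomy u s with l | l | l
      · exact absurd ((le_inf hu (T.acyc _ _ l)).trans (h1'.trans inf_le_right)) (T.diag u)
      · exact l
      · exact absurd (le_inf hs (T.acyc _ _ l)) h2'
    subst e
    have : q = ⟨a ⊓ m u, inf_le_left⟩ := Subtype.ext hqu
    exact this ▸ hq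
  · intro b hb
    obtain ⟨i, hi⟩ := T.jsurj b.1 (ji_Iic.1 hb)
    exact ⟨⟨i, hi ▸ b.2⟩, Subtype.ext hi⟩
  · intro b hb
    obtain ⟨u, hu⟩ := hms b hb
    exact ⟨u, Subtype.ext hu.symm⟩
  · intro i k h
    exact le_inf i.2 (T.acyc _ _ h)
  · intro i h
    exact T.diag i.1 (le_trans (show j i.1 ≤ a ⊓ m i.1 from h) inf_le_right)
  · intro y z h
    obtain ⟨s, h1, h2⟩ := T.ex _ _ (coe_covBy_Iic.1 h)
    exact ⟨⟨s, h1.trans z.2⟩, h1, le_inf y.2 h2⟩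
  · intro y z h i k h1 h2 h3 h4
    exact Subtype.ext (T.uniq _ _ (coe_covBy_Iic.1 h) _ _ h1
      (le_trans (show y.1 ≤ a ⊓ m i.1 from h2) inf_le_right) h3
      (le_trans (show y.1 ≤ a ⊓ m k.1 from h4) inf_le_right))

theorem ici (T : TD α ι j m) (a : α) :
    TD (Set.Ici a) {s : ι // a ≤ m s} (fun s => ⟨a ⊔ j s.1, Set.mem_Ici.mpr le_sup_left⟩)
      (fun s => ⟨m s.1, s.2⟩) := by
  have hms : ∀ q : Set.Ici a, JoinIrred q → ∃ u : {s : ι // a ≤ m s}, q.1 = a ⊔ j u.1 := by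
    intro q hq
    obtain ⟨w, hw, -⟩ := id hq
    obtain ⟨s, h1, h2⟩ := T.ex _ _ (coe_covBy_Ici.1 hw)
    refine ⟨⟨s, le_trans w.2 h2⟩, ?_⟩
    have hle : (⟨a ⊔ j s, Set.mem_Ici.mpr le_sup_left⟩ : Set.Ici a) ≤ q := sup_le q.2 h1
    rcases hle.eq_or_lt with e | l
    · exact (Subtype.ext_iff.1 e).symm
    · have h5 := ji_le hq hw l
      have : a ⊔ j s ≤ w.1 := h5
      exact absurd ((le_sup_right.trans this).trans h2) (T.diag s)
  refine ⟨?_, fun i => mi_Ici.2 (T.mirr _), ?_, ?_, ?_, ?_, ?_, ?_⟩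
  · rintro ⟨s, hs⟩
    have hn : ¬ ((⟨a ⊔ j s, Set.mem_Ici.mpr le_sup_left⟩ : Set.Ici a) ≤ ⟨m s, hs⟩) :=
      fun h => T.diag s (le_sup_right.trans (show a ⊔ j s ≤ m s from h))
    obtain ⟨q, hq, h1, h2⟩ := exists_ji hn
    obtain ⟨⟨u, hu⟩, hqu⟩ := hms q hq
    have h1' : q.1 ≤ a ⊔ j s := h1
    have h2' : ¬ q.1 ≤ m s := h2
    rw [hqu] at h1' h2'
    have e : u = s := by
      rcases lt_trichotomy u s with l | l | l
      · exact absurd (sup_le hs (T.acyc _ _ l)) h2'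
      · exact l
      · exact absurd ((le_sup_right.trans h1').trans (sup_le hu (T.acyc _ _ l))) (T.diag u)
    subst e
    have : q = ⟨a ⊔ j u, Set.mem_Ici.mpr le_sup_left⟩ := Subtype.ext hqu
    exact this ▸ hq
  · intro b hb
    obtain ⟨u, hu⟩ := hms b hb
    exact ⟨u, Subtype.ext hu.symm⟩
  · intro b hb
    obtain ⟨i, hi⟩ := T.msurj b.1 (mi_Ici.1 hb)
    exact ⟨⟨i, hi ▸ b.2⟩, Subtype.ext hi⟩
  · intro i k h
    exact sup_le k.2 (T.acyc _ _ h)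
  · intro i h
    exact T.diag i.1 (le_sup_right.trans (show a ⊔ j i.1 ≤ m i.1 from h))
  · intro y z h
    obtain ⟨s, h1, h2⟩ := T.ex _ _ (coe_covBy_Ici.1 h)
    exact ⟨⟨s, le_trans y.2 h2⟩, sup_le z.2 h1, h2⟩
  · intro y z h i k h1 h2 h3 h4
    exact Subtype.ext (T.uniq _ _ (coe_covBy_Ici.1 h) _ _
      (le_sup_right.trans (show a ⊔ j i.1 ≤ z.1 from h1)) h2
      (le_sup_right.trans (show a ⊔ j k.1 ≤ z.1 from h3)) h4)

theorem cd (N : ℕ) : ∀ (α : Type u) [Lattice α] [Finite α] [Nonempty α] (ι : Type)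
    [LinearOrder ι] [Finite ι] (j m : ι → α), TD α ι j m → Nat.card α ≤ N →
    CompatiblyDismantlable α := by
  induction N with
  | zero =>
    intro α _ _ _ ι _ _ j m _ h
    exact absurd (Nat.card_pos (α := α)) (by omega)
  | succ N ih =>
    intro α _ _ _ ι _ _ j m T hN
    by_cases h1 : Nat.card α = 1
    · exact .singleton α h1
    have hnt : Nontrivial α := by
      rw [← Finite.one_lt_card_iff_nontrivial]
      have := Nat.card_pos (α := α)
      omega
    obtain ⟨a, b, hab⟩ := exists_pair_ne α
    have hlt : a ⊓ b < a ⊔ b := inf_lt_sup.2 hab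
    obtain ⟨i0, -⟩ := T.lab hlt
    obtain ⟨t, ht⟩ := (Set.toFinite (Set.univ : Set ι)).exists_maximal ⟨i0, trivial⟩
    have hmax : ∀ s, s ≤ t := by
      intro s
      rcases le_total s t with l | l
      · exact l
      · exact ht.2 trivial l
    obtain ⟨κ, hκ, hκu, hκv⟩ := T.pairing
    have Td := T.iic (m t)
    have Tu := T.ici (j t)
    obtain ⟨κd, hκd, hκdu, hκdv⟩ := Td.pairing
    obtain ⟨κu, hκup, hκuu, hκuv⟩ := Tu.pairing
    have cdn : CompatiblyDismantlable (Set.Iic (m t)) := by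
      haveI : Nonempty (Set.Iic (m t)) := ⟨⟨m t, le_rfl⟩⟩
      refine ih _ _ _ _ Td ?_
      have : Nat.card (Set.Iic (m t)) < Nat.card α :=
        Finite.card_subtype_lt (x := j t) (T.diag t)
      omega
    have cup : CompatiblyDismantlable (Set.Ici (j t)) := by
      haveI : Nonempty (Set.Ici (j t)) := ⟨⟨j t, le_rfl⟩⟩
      refine ih _ _ _ _ Tu ?_
      have : Nat.card (Set.Ici (j t)) < Nat.card α :=
        Finite.card_subtype_lt (x := m t) (T.diag t)
      omega
    refine .step α κ hκ hκu (j t) (m t) ?_ cup cdn κu hκup hκuu κd hκd hκdu ?_ ?_ ?_ ?_ ?_ ?_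
    · intro z
      refine ⟨?_, fun h => T.diag t (h.2.trans h.1)⟩
      by_contra hn
      push Not at hn
      have hl : z ⊓ m t < z := lt_of_le_of_ne inf_le_left
        (fun e => hn.1 (by rw [← e]; exact inf_le_right))
      obtain ⟨s, h1, h2⟩ := T.lab hl
      rcases (hmax s).eq_or_lt with e | l
      · exact hn.2 (e ▸ h1)
      · exact T.diag s ((le_inf h1 (T.acyc _ _ l)).trans h2)
    · rintro ⟨a, ha⟩ h
      obtain ⟨i, rfl⟩ := T.jsurj a ha
      rw [hκv] at h ⊢
      exact ⟨Tu.jirr ⟨i, h⟩, by rw [hκuv ⟨i, h⟩]⟩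
    · rintro ⟨a, ha⟩ ⟨b, hb⟩ h h' e
      obtain ⟨i, rfl⟩ := T.jsurj a ha
      obtain ⟨k, rfl⟩ := T.jsurj b hb
      rw [hκv] at h h'
      have := Tu.jinj (i := ⟨i, h⟩) (k := ⟨k, h'⟩) (Subtype.ext e)
      have e2 : i = k := Subtype.ext_iff.1 this
      subst e2; rfl
    · rintro ⟨a, ha⟩
      obtain ⟨i, hi⟩ := Tu.jsurj a ha
      exact ⟨⟨j i.1, T.jirr _⟩, by rw [hκv]; exact i.2, Subtype.ext_iff.1 hi⟩
    · rintro ⟨a, ha⟩ h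
      obtain ⟨i, rfl⟩ := T.jsurj a ha
      rw [hκv]
      exact ⟨Td.jirr ⟨i, h⟩, by rw [hκdv ⟨i, h⟩]⟩
    · rintro ⟨a, ha⟩ ⟨b, hb⟩ h h' e
      obtain ⟨i, rfl⟩ := T.jsurj a ha
      obtain ⟨k, rfl⟩ := T.jsurj b hb
      rw [hκv, hκv] at e
      have := Td.minj (i := ⟨i, h⟩) (k := ⟨k, h'⟩) (Subtype.ext e)
      have e2 : i = k := Subtype.ext_iff.1 this
      subst e2; rfl
    · rintro ⟨a, ha⟩
      obtain ⟨i, hi⟩ := Td.msurj a ha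
      exact ⟨⟨j i.1, T.jirr _⟩, i.2, by rw [hκv]; exact Subtype.ext_iff.1 hi⟩

theorem semidistrim [Nonempty α] (T : TD α ι j m) : Semidistrim α := by
  refine ⟨cd _ α ι j m T le_rfl, ?_⟩
  obtain ⟨κ0, hκ, hκu, hκv⟩ := T.pairing
  intro κ hk x
  obtain rfl := hκu κ hk
  constructor
  · rintro ⟨a, ha⟩ ⟨y, hy, h1, h2⟩ ⟨b, hb⟩ ⟨y', hy', h1', h2'⟩ ⟨hne, hn⟩
    obtain ⟨i, rfl⟩ := T.jsurj a ha
    obtain ⟨k, rfl⟩ := T.jsurj b hb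
    rw [hκv] at h2 h2' hn
    rcases lt_trichotomy i k with l | l | l
    · exact hn (T.acyc _ _ l)
    · subst l; exact hne rfl
    · exact hn (T.indepD hy' hy h1' h2' h1 h2 l)
  · rintro ⟨a, ha⟩ ⟨y, hy, h1, h2⟩ ⟨b, hb⟩ ⟨y', hy', h1', h2'⟩ ⟨hne, hn⟩
    obtain ⟨i, rfl⟩ := T.jsurj a ha
    obtain ⟨k, rfl⟩ := T.jsurj b hb
    rw [hκv] at h2 h2' hn
    rcases lt_trichotomy i k with l | l | l
    · exact hn (T.acyc _ _ l)
    · subst l; exact hne rfl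
    · exact hn (T.indepU hy' hy h1' h2' h1 h2 l)

end TD

/-- Step of a chain at which `y ⊔ c i` first contains `z`. -/
theorem chain_label {α : Type u} [Lattice α] [BoundedOrder α] {k : ℕ} {c : Fin (k + 1) → α}
    (c0 : c 0 = ⊥) (cl : c (Fin.last k) = ⊤) {y z : α} (h : y < z) :
    ∃ i : Fin k, z ≤ y ⊔ c i.succ ∧ ¬ z ≤ y ⊔ c i.castSucc := by
  by_contra hn
  push Not at hn
  have : ∀ i : Fin (k + 1), ¬ z ≤ y ⊔ c i := by
    intro i
    induction i using Fin.induction with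
    | zero => rw [c0, sup_bot_eq]; exact h.not_ge
    | succ i ih => exact fun h' => ih (hn i h')
  exact this (Fin.last k) (by rw [cl, sup_top_eq]; exact le_top)

theorem lm_not_le {α : Type u} [Lattice α] {y z a b : α} (hm : LeftModular a) (hyz : y ≤ z)
    (h1 : z ≤ y ⊔ a) (h2 : ¬ z ≤ y ⊔ b) : ¬ a ⊓ z ≤ b := by
  intro h
  apply h2
  have := hm y z hyz
  rw [inf_eq_right.2 h1] at this
  rw [this]
  exact sup_le_sup_left h y

theorem trim_TD {α : Type u} [Lattice α] [BoundedOrder α] [Finite α] (h : Trim α) :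
    ∃ (n : ℕ) (j m : Fin n → α), TD α (Fin n) j m := by
  obtain ⟨⟨n, d, d0, dl, dcov, dmax, hJ, hM⟩, k, c, c0, cl, ccov, cmod⟩ := h
  have cmono : StrictMono c := Fin.strictMono_iff_lt_succ.2 fun i => (ccov i).lt
  have dmono : StrictMono d := Fin.strictMono_iff_lt_succ.2 fun i => (dcov i).lt
  have hkn : k ≤ n := dmax k c cmono
  have hnk : n ≤ k := by
    choose f hf1 hf2 using fun i : Fin n => chain_label c0 cl (dcov i).lt
    have key : ∀ a b, a < b → f a ≠ f b := by
      intro a b hab e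
      have h1 := lm_not_le (cmod _) (dcov a).le (hf1 a) (hf2 a)
      have hcov := ccov (f a)
      have h2 : c (f a).castSucc ⊔ (c (f a).succ ⊓ d a.succ) = c (f a).succ := by
        rcases hcov.eq_or_eq le_sup_left (sup_le hcov.le inf_le_left) with e' | e'
        · exact absurd (by rw [← e']; exact le_sup_right) h1
        · exact e'
      have h3 : d a.succ ≤ d b.castSucc := dmono.monotone (by
        rw [Fin.le_def]; simp only [Fin.val_succ, Fin.val_castSucc]; exact hab)
      apply hf2 b
      refine (hf1 b).trans (sup_le le_sup_left ?_)
      rw [← e, ← h2]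
      exact sup_le le_sup_right ((inf_le_right.trans h3).trans le_sup_left)
    have finj : Function.Injective f := by
      intro a b e
      rcases lt_trichotomy a b with l | l | l
      · exact absurd e (key _ _ l)
      · exact l
      · exact absurd e.symm (key _ _ l)
    simpa using Fintype.card_le_of_injective f finj
  obtain rfl : k = n := le_antisymm hkn hnk
  choose j hj1 hj2 hj3 using fun i : Fin k => exists_ji (ccov i).lt.not_ge
  choose m hm1 hm2 hm3 using fun i : Fin k => exists_mi (ccov i).lt.not_ge
  have hc : ∀ a b : Fin k, a < b → c a.succ ≤ c b.castSucc := by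
    intro a b hab
    exact cmono.monotone (by
      rw [Fin.le_def]; simp only [Fin.val_succ, Fin.val_castSucc]; exact hab)
  have acyc : ∀ a b, a < b → j a ≤ m b := fun a b hab =>
    ((hj2 a).trans (hc a b hab)).trans (hm2 b)
  have diag : ∀ a, ¬ j a ≤ m a := by
    intro a ha
    rcases (ccov a).eq_or_eq (c := c a.castSucc ⊔ j a) le_sup_left
      (sup_le (ccov a).le (hj2 a)) with e | e
    · exact hj3 a (by rw [← e]; exact le_sup_right)
    · exact hm3 a (by rw [← e]; exact sup_le (hm2 a) ha)
  have jinj : Function.Injective (fun i => (⟨j i, hj1 i⟩ : {j : α // JoinIrred j})) := by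
    intro a b e
    have e : j a = j b := Subtype.ext_iff.1 e
    rcases lt_trichotomy a b with l | l | l
    · exact absurd (e ▸ acyc _ _ l) (diag b)
    · exact l
    · exact absurd (e ▸ acyc _ _ l) (diag a)
  have minj : Function.Injective (fun i => (⟨m i, hm1 i⟩ : {m : α // MeetIrred m})) := by
    intro a b e
    have e : m a = m b := Subtype.ext_iff.1 e
    rcases lt_trichotomy a b with l | l | l
    · exact absurd (e ▸ acyc _ _ l) (diag a)
    · exact l
    · exact absurd (e ▸ acyc _ _ l) (diag b)
  have jb := (Nat.bijective_iff_injective_and_card _).2 ⟨jinj, by simp [hJ]⟩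
  have mb := (Nat.bijective_iff_injective_and_card _).2 ⟨minj, by simp [hM]⟩
  have jsurj : ∀ a, JoinIrred a → ∃ i, j i = a := fun a ha => by
    obtain ⟨i, hi⟩ := jb.2 ⟨a, ha⟩
    exact ⟨i, Subtype.ext_iff.1 hi⟩
  have msurj : ∀ a, MeetIrred a → ∃ i, m i = a := fun a ha => by
    obtain ⟨i, hi⟩ := mb.2 ⟨a, ha⟩
    exact ⟨i, Subtype.ext_iff.1 hi⟩
  refine ⟨k, j, m, hj1, hm1, jsurj, msurj, acyc, diag, ?_, ?_⟩
  · intro y z hyz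
    obtain ⟨i, h1, h2⟩ := chain_label c0 cl hyz.lt
    refine ⟨i, ?_, ?_⟩
    · obtain ⟨q, hq, hq1, hq2⟩ := exists_ji (lm_not_le (cmod _) hyz.le h1 h2)
      obtain ⟨s, rfl⟩ := jsurj q hq
      rcases lt_trichotomy s i with l | l | l
      · exact absurd ((hj2 s).trans (hc _ _ l)) hq2
      · exact l ▸ hq1.trans inf_le_right
      · exact absurd ((hq1.trans inf_le_left).trans (hc _ _ l)) (hj3 s)
    · have hn : ¬ c i.succ ≤ y ⊔ c i.castSucc := fun h =>
        h2 (h1.trans (sup_le le_sup_left h))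
      obtain ⟨q, hq, hq1, hq2⟩ := exists_mi hn
      obtain ⟨s, rfl⟩ := msurj q hq
      rcases lt_trichotomy s i with l | l | l
      · exact absurd ((hc _ _ l).trans (le_sup_right.trans hq1)) (hm3 s)
      · exact l ▸ le_sup_left.trans hq1
      · exact absurd ((hc _ _ l).trans (hm2 s)) hq2
  · intro y z hyz
    have key : ∀ a b, j a ≤ z → y ≤ m a → j b ≤ z → y ≤ m b → ¬ a < b := by
      intro a b h1 h2 h3 h4 l
      have hz : y ⊔ j a = z := by
        rcases hyz.eq_or_eq (c := y ⊔ j a) le_sup_left (sup_le hyz.le h1) with e | e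
        · exact absurd (le_trans (by rw [← e]; exact le_sup_right) h2) (diag a)
        · exact e
      have : z ≤ m b := by rw [← hz]; exact sup_le h4 (acyc _ _ l)
      exact diag b (h3.trans this)
    intro a b h1 h2 h3 h4
    exact le_antisymm (not_lt.1 (key b a h3 h4 h1 h2)) (not_lt.1 (key a b h1 h2 h3 h4))

end helpers

/-- every finite trim lattice is semidistrim. -/
theorem stmt11 {α : Type u} [Lattice α] [BoundedOrder α] [Finite α]
    (h : Trim α) :
    Semidistrim α := by
  obtain ⟨n, j, m, T⟩ := trim_TD h
  haveI : Nonempty α := ⟨⊥⟩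
  exact T.semidistrim
end

section
/- Let L be a finite semidistrim lattice. For every x ∈ L, the pair (D_L(x), U_L(x)) is a tight orthogonal pair of the Galois graph G_L. -/
universe u

/-- An orthogonal pair of the Galois graph: disjoint independent sets `X`, `Y` with no
edge `j → j'` for `j ∈ X`, `j' ∈ Y`. -/
def OrthPair {α : Type u} [Lattice α]
    (κ : {j : α // JoinIrred j} → {m : α // MeetIrred m})
    (X Y : Set {j : α // JoinIrred j}) : Prop :=
  IndepSet κ X ∧ IndepSet κ Y ∧ Disjoint X Y ∧
    ∀ j ∈ X, ∀ j' ∈ Y, ¬ GaloisEdge κ j j'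

/-- A tight orthogonal pair of the Galois graph. -/
def TightOrthPair {α : Type u} [Lattice α]
    (κ : {j : α // JoinIrred j} → {m : α // MeetIrred m})
    (X Y : Set {j : α // JoinIrred j}) : Prop :=
  OrthPair κ X Y ∧
    (∀ j, j ∉ X ∪ Y → ¬ OrthPair κ (X ∪ {j}) Y ∧ ¬ OrthPair κ X (Y ∪ {j})) ∧
    (∀ j j', j ∉ X ∪ Y → j' ∈ X → GaloisEdge κ j j' →
      ¬ OrthPair κ ((X \ {j'}) ∪ {j}) Y) ∧
    (∀ j j', j ∉ X ∪ Y → j' ∈ Y → GaloisEdge κ j' j →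
      ¬ OrthPair κ X ((Y \ {j'}) ∪ {j}))


theorem pr_exLUB {α : Type u} [Lattice α] [Finite α] [Nonempty α] (S : Set α) :
    ∃ z, IsLUB S z := by
  classical
  let := Fintype.ofFinite α
  let : BoundedOrder α := Fintype.toBoundedOrder α
  refine ⟨S.toFinset.sup id, ?_⟩
  have := Finset.isLUB_sup_id (s := S.toFinset)
  simpa using this

theorem pr_exGLB {α : Type u} [Lattice α] [Finite α] [Nonempty α] (S : Set α) :
    ∃ z, IsGLB S z := by
  classical
  let := Fintype.ofFinite α
  let : BoundedOrder α := Fintype.toBoundedOrder α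
  refine ⟨S.toFinset.inf id, ?_⟩
  have := Finset.isGLB_inf_id (s := S.toFinset)
  simpa using this

section
variable {α : Type u} [Lattice α] [Finite α]
    {κ : {j : α // JoinIrred j} → {m : α // MeetIrred m}}

theorem pr_not_le (hκ : IsPairing κ) (j : {j : α // JoinIrred j}) : ¬ j.1 ≤ (κ j).1 := by
  intro h
  obtain ⟨c, hc, -⟩ := j.2
  have h1 : j.1 ⊓ (κ j).1 = c := (hκ.2.1 j c hc).1
  rw [inf_eq_left.mpr h] at h1
  exact hc.lt.ne' h1

theorem pr_low (hκ : IsPairing κ) (j : {j : α // JoinIrred j}) {w : α} (h : w < j.1) :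
    w ≤ (κ j).1 := by
  obtain ⟨c, hwc, hc⟩ := exists_le_covBy_of_lt h
  have h1 : j.1 ⊓ (κ j).1 = c := (hκ.2.1 j c hc).1
  exact hwc.trans (h1 ▸ inf_le_right)

theorem pr_high (hκ : IsPairing κ) (j : {j : α // JoinIrred j}) {w : α} (h : (κ j).1 < w) :
    j.1 ≤ w := by
  obtain ⟨c, hc, hcw⟩ := exists_covBy_le_of_lt h
  have h1 : (κ j).1 ⊔ j.1 = c := (hκ.2.2 j c hc).1
  exact le_trans (h1 ▸ le_sup_right) hcw
end

theorem pr_prime {β : Type u} [Lattice β] [Finite β] 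
    {κ : {j : β // JoinIrred j} → {m : β // MeetIrred m}} (hκ : IsPairing κ)
    {j0 m0 : β} (hpp : IsPrimePair j0 m0) :
    ∃ h : JoinIrred j0, (κ ⟨j0, h⟩).1 = m0 := by
  have hn : ¬ j0 ≤ m0 := fun h => (hpp j0).2 ⟨h, le_rfl⟩
  have key : ∀ w, w < j0 → w ≤ j0 ⊓ m0 := fun w hw =>
    le_inf hw.le ((hpp w).1.resolve_right (not_le_of_gt hw))
  have hlt : j0 ⊓ m0 < j0 := lt_of_le_of_ne inf_le_left (fun h => hn (inf_eq_left.mp h))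
  have hc : j0 ⊓ m0 ⋖ j0 := ⟨hlt, fun w h1 h2 => not_le_of_gt h1 (key w h2)⟩
  have hj : JoinIrred j0 := by
    refine ⟨_, hc, fun y hy => ?_⟩
    exact (hy.eq_or_eq (key y hy.lt) inf_le_left).resolve_right hlt.ne |>.symm
  refine ⟨hj, ?_⟩
  have h1 : (κ ⟨j0, hj⟩).1 ≤ m0 := (hpp _).1.resolve_right (pr_not_le hκ ⟨j0, hj⟩)
  exact le_antisymm h1 ((hκ.2.1 ⟨j0, hj⟩ _ hc).2 rfl h1)

theorem pr_main (β : Type u) [Lattice β] [Finite β] (h : CompatiblyDismantlable β) :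
    ∀ κ : {j : β // JoinIrred j} → {m : β // MeetIrred m}, IsPairing κ →
      (∀ (u : β) j j', u ≤ (κ j).1 → u ≤ (κ j').1 → u ⊔ j.1 = u ⊔ j'.1 → j = j') ∧
      (∀ (v : β) j j', j.1 ≤ v → j'.1 ≤ v → v ⊓ (κ j).1 = v ⊓ (κ j').1 → j = j') ∧
      (∀ x y : β, x < y → ∃ j, j.1 ≤ y ∧ x ≤ (κ j).1) := by
  induction h with
  | singleton β h =>
    intro κ hκ
    have hs : Subsingleton β := (Nat.card_eq_one_iff_unique.mp h).1
    refine ⟨fun _ j j' _ _ _ => Subtype.ext (Subsingleton.elim _ _),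
      fun _ j j' _ _ _ => Subtype.ext (Subsingleton.elim _ _), fun x y hxy => ?_⟩
    exact absurd (Subsingleton.elim x y) hxy.ne
  | step β κ hκ huniq j0 m0 hpp hup hdn κup hκup _ κdn hκdn _ halpha halphainj halphasurj
      hbeta hbetainj hbetasurj ihup ihdn =>
    intro κ' hκ'
    obtain rfl := huniq κ' hκ'
    obtain ⟨U1, U2, U3⟩ := ihup κup hκup
    obtain ⟨D1, D2, D3⟩ := ihdn κdn hκdn
    obtain ⟨hj0, hm0⟩ := pr_prime hκ hpp
    have caseU : ∀ (u : β) j j', j0 ≤ u → u ≤ (κ' j).1 → u ≤ (κ' j').1 →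
        u ⊔ j.1 = u ⊔ j'.1 → j = j' := by
      intro u j j' hu h1 h2 h3
      obtain ⟨a, ha⟩ := halpha j (hu.trans h1)
      obtain ⟨b, hb⟩ := halpha j' (hu.trans h2)
      have := U1 ⟨u, hu⟩ ⟨_, a⟩ ⟨_, b⟩ (by rw [← Subtype.coe_le_coe, ha]; exact h1)
        (by rw [← Subtype.coe_le_coe, hb]; exact h2)
        (by
          apply Subtype.ext
          change u ⊔ (j0 ⊔ j.1) = u ⊔ (j0 ⊔ j'.1)
          rw [← sup_assoc, ← sup_assoc, sup_eq_left.mpr hu, h3])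
      exact halphainj j j' (hu.trans h1) (hu.trans h2)
        (congrArg (fun z => z.1.1) this)
    have caseD : ∀ (v : β) j j', v ≤ m0 → j.1 ≤ v → j'.1 ≤ v →
        v ⊓ (κ' j).1 = v ⊓ (κ' j').1 → j = j' := by
      intro v j j' hv h1 h2 h3
      obtain ⟨a, ha⟩ := hbeta j (h1.trans hv)
      obtain ⟨b, hb⟩ := hbeta j' (h2.trans hv)
      have := D2 ⟨v, hv⟩ ⟨_, a⟩ ⟨_, b⟩ h1 h2
        (by
          apply Subtype.ext
          change v ⊓ (κdn _).1.1 = v ⊓ (κdn _).1.1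
          rw [ha, hb, ← inf_assoc, ← inf_assoc, inf_eq_left.mpr hv, h3])
      exact Subtype.ext (congrArg (fun z => z.1.1) this)
    refine ⟨?_, ?_, ?_⟩
    · intro u j j' h1 h2 h3
      rcases (hpp u).1 with hu | hu
      swap
      · exact caseU u j j' hu h1 h2 h3
      rcases (hpp (u ⊔ j.1)).1 with hx | hx
      · have k1 : j.1 ≤ m0 := le_sup_right.trans hx
        have k2 : j'.1 ≤ m0 := le_sup_right.trans (h3 ▸ hx)
        obtain ⟨a, ha⟩ := hbeta j k1
        obtain ⟨b, hb⟩ := hbeta j' k2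
        have := D1 ⟨u, hu⟩ ⟨_, a⟩ ⟨_, b⟩
          (by rw [← Subtype.coe_le_coe, ha]; exact le_inf hu h1)
          (by rw [← Subtype.coe_le_coe, hb]; exact le_inf hu h2)
          (Subtype.ext h3)
        exact Subtype.ext (congrArg (fun z => z.1.1) this)
      · have k1 : j0 ≤ j.1 := (hpp _).1.resolve_left
          (fun h => (hpp _).2 ⟨sup_le hu h, hx⟩)
        have k2 : j0 ≤ j'.1 := (hpp _).1.resolve_left
          (fun h => (hpp _).2 ⟨sup_le hu h, h3 ▸ hx⟩)
        rcases eq_or_lt_of_le k1 with e1 | e1 <;> rcases eq_or_lt_of_le k2 with e2 | e2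
        · exact Subtype.ext (e1.symm.trans e2)
        · refine absurd ?_ (pr_not_le hκ j')
          calc j'.1 ≤ u ⊔ j.1 := h3 ▸ le_sup_right
            _ ≤ _ := sup_le h2 (e1 ▸ pr_low hκ j' e2)
        · refine absurd ?_ (pr_not_le hκ j)
          calc j.1 ≤ u ⊔ j'.1 := h3 ▸ le_sup_right
            _ ≤ _ := sup_le h1 (e2 ▸ pr_low hκ j e1)
        · refine caseU (u ⊔ j0) j j' le_sup_right (sup_le h1 (pr_low hκ j e1))
            (sup_le h2 (pr_low hκ j' e2)) ?_
          rw [sup_assoc, sup_assoc, sup_eq_right.mpr k1, sup_eq_right.mpr k2, h3]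
    · intro v j j' h1 h2 h3
      rcases (hpp v).1 with hv | hv
      · exact caseD v j j' hv h1 h2 h3
      rcases (hpp (v ⊓ (κ' j).1)).1 with hx | hx
      swap
      · have k1 : j0 ≤ (κ' j).1 := hx.trans inf_le_right
        have k2 : j0 ≤ (κ' j').1 := (h3 ▸ hx : j0 ≤ v ⊓ (κ' j').1).trans inf_le_right
        obtain ⟨a, ha⟩ := halpha j k1
        obtain ⟨b, hb⟩ := halpha j' k2
        have := U2 ⟨v, hv⟩ ⟨_, a⟩ ⟨_, b⟩ (sup_le hv h1) (sup_le hv h2)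
          (by
            apply Subtype.ext
            change v ⊓ (κup _).1.1 = v ⊓ (κup _).1.1
            rw [ha, hb, h3])
        exact halphainj j j' k1 k2 (congrArg (fun z => z.1.1) this)
      · have k1 : (κ' j).1 ≤ m0 := (hpp _).1.resolve_right
          (fun h => (hpp _).2 ⟨hx, le_inf hv h⟩)
        have k2 : (κ' j').1 ≤ m0 := (hpp _).1.resolve_right
          (fun h => (hpp _).2 ⟨h3 ▸ hx, le_inf hv h⟩)
        rcases eq_or_lt_of_le k1 with e1 | e1 <;> rcases eq_or_lt_of_le k2 with e2 | e2
        · exact hκ.1.1 (Subtype.ext (e1.trans e2.symm))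
        · refine absurd ?_ (pr_not_le hκ j')
          calc j'.1 ≤ v ⊓ (κ' j).1 := le_inf h2 (e1 ▸ pr_high hκ j' e2)
            _ ≤ _ := h3 ▸ inf_le_right
        · refine absurd ?_ (pr_not_le hκ j)
          calc j.1 ≤ v ⊓ (κ' j').1 := le_inf h1 (e2 ▸ pr_high hκ j e1)
            _ ≤ _ := h3 ▸ inf_le_right
        · refine caseD (v ⊓ m0) j j' inf_le_right (le_inf h1 (pr_high hκ j e1))
            (le_inf h2 (pr_high hκ j' e2)) ?_
          rw [inf_assoc, inf_assoc, inf_eq_right.mpr k1, inf_eq_right.mpr k2, h3]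
    · intro x y hxy
      rcases (hpp x).1 with hx | hx
      swap
      · obtain ⟨i, hi1, hi2⟩ := U3 ⟨x, hx⟩ ⟨y, hx.trans hxy.le⟩ hxy
        obtain ⟨j, hj1, hj2⟩ := halphasurj i
        obtain ⟨a, ha⟩ := halpha j hj1
        have e : i = ⟨_, a⟩ := Subtype.ext (Subtype.ext hj2.symm)
        subst e
        refine ⟨j, le_sup_right.trans (show j0 ⊔ j.1 ≤ y from hi1), ?_⟩
        rw [← ha]; exact hi2
      rcases (hpp y).1 with hy | hy
      · obtain ⟨i, hi1, hi2⟩ := D3 ⟨x, hx⟩ ⟨y, hy⟩ hxy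
        obtain ⟨j, hj1, hj2⟩ := hbetasurj (κdn i)
        obtain ⟨a, ha⟩ := hbeta j hj1
        have e : ⟨_, a⟩ = i := hκdn.1.1 (Subtype.ext (Subtype.ext (ha.trans hj2)))
        subst e
        refine ⟨j, hi1, ?_⟩
        have : x ≤ m0 ⊓ (κ' j).1 := by rw [← ha]; exact hi2
        exact this.trans inf_le_right
      · exact ⟨⟨j0, hj0⟩, hy, by rw [hm0]; exact hx⟩

/-- in a semidistrim lattice, `(D_L(x), U_L(x))` is a tight orthogonal pair
of the Galois graph for every `x`. -/
theorem stmt13 {α : Type u} [Lattice α] [Finite α]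
    (hsd : Semidistrim α)
    (κ : {j : α // JoinIrred j} → {m : α // MeetIrred m})
    (hκ : IsPairing κ) (huniq : ∀ κ', IsPairing κ' → κ' = κ) (x : α) :
    TightOrthPair κ (DLabel κ x) (ULabel κ x) := by
  obtain ⟨hB, hB', hE⟩ := pr_main α hsd.1 κ hκ
  obtain ⟨hD, hU⟩ := hsd.2 κ hκ x
  haveI : Nonempty α := ⟨x⟩
  have dle : ∀ j ∈ DLabel κ x, j.1 ≤ x := fun j ⟨y, _, h, _⟩ => h
  have ule : ∀ j ∈ ULabel κ x, x ≤ (κ j).1 := fun j ⟨y, _, _, h⟩ => h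
  -- joins and meets
  have low : ∀ w, w ≤ x → (∀ d ∈ DLabel κ x, ∃ t, t ≤ w ∧ ¬ t ≤ (κ d).1) → w = x := by
    intro w hw h
    by_contra hne
    obtain ⟨y, hwy, hy⟩ := exists_le_covBy_of_lt (lt_of_le_of_ne hw hne)
    obtain ⟨d, hd1, hd2⟩ := hE y x hy.lt
    obtain ⟨t, ht, ht2⟩ := h d ⟨y, hy, hd1, hd2⟩
    exact ht2 (ht.trans (hwy.trans hd2))
  have high : ∀ w, x ≤ w → (∀ d ∈ ULabel κ x, ∃ t, w ≤ t ∧ ¬ d.1 ≤ t) → w = x := by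
    intro w hw h
    by_contra hne
    obtain ⟨y, hy, hyw⟩ := exists_covBy_le_of_lt (lt_of_le_of_ne hw (Ne.symm hne))
    obtain ⟨d, hd1, hd2⟩ := hE x y hy.lt
    obtain ⟨t, ht, ht2⟩ := h d ⟨y, hy, hd1, hd2⟩
    exact ht2 (hd1.trans (hyw.trans ht))
  have lowx : ∀ w, (∀ d ∈ DLabel κ x, d.1 ≤ w) → x ≤ w := by
    intro w h
    have := low (w ⊓ x) inf_le_right
      (fun d hd => ⟨d.1, le_inf (h d hd) (dle d hd), pr_not_le hκ d⟩)
    exact inf_eq_right.mp this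
  have highx : ∀ w, (∀ d ∈ ULabel κ x, w ≤ (κ d).1) → w ≤ x := by
    intro w h
    have := high (w ⊔ x) le_sup_right
      (fun d hd => ⟨(κ d).1, sup_le (h d hd) (ule d hd), pr_not_le hκ d⟩)
    exact sup_eq_right.mp this
  have ne_le : ∀ {a b : {j : α // JoinIrred j}}, ¬ GaloisEdge κ a b → a ≠ b →
      a.1 ≤ (κ b).1 := by
    intro a b h hne
    by_contra hc
    exact h ⟨hne, hc⟩
  refine ⟨⟨hD, hU, ?_, ?_⟩, ?_, ?_, ?_⟩
  · rw [Set.disjoint_left]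
    intro j h1 h2
    exact pr_not_le hκ j ((dle j h1).trans (ule j h2))
  · intro j h1 j' h2 h
    exact h.2 ((dle j h1).trans (ule j' h2))
  · intro j hj
    have hjD : j ∉ DLabel κ x := fun h => hj (Or.inl h)
    have hjU : j ∉ ULabel κ x := fun h => hj (Or.inr h)
    constructor
    · rintro ⟨h1, -, -, h4⟩
      refine pr_not_le hκ j (le_trans (highx _ fun d hd => ?_) (lowx _ fun d hd => ?_))
      · exact ne_le (h4 j (Or.inr rfl) d hd) (fun e => hjU (e ▸ hd))
      · exact ne_le (h1 d (Or.inl hd) j (Or.inr rfl)) (fun e => hjD (e ▸ hd))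
    · rintro ⟨-, h2, -, h4⟩
      refine pr_not_le hκ j (le_trans (highx _ fun d hd => ?_) (lowx _ fun d hd => ?_))
      · exact ne_le (h2 j (Or.inr rfl) d (Or.inl hd)) (fun e => hjU (e ▸ hd))
      · exact ne_le (h4 d hd j (Or.inr rfl)) (fun e => hjD (e ▸ hd))
  · rintro j j' hj hj' hedge ⟨h1, -, -, h4⟩
    have hjD : j ∉ DLabel κ x := fun h => hj (Or.inl h)
    have hjU : j ∉ ULabel κ x := fun h => hj (Or.inr h)
    have hjx : j.1 ≤ x := highx _ fun d hd =>
      ne_le (h4 j (Or.inr rfl) d hd) (fun e => hjU (e ▸ hd))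
    obtain ⟨z, hz⟩ := pr_exLUB (Subtype.val '' (DLabel κ x \ {j'}))
    have hzd : ∀ d ∈ DLabel κ x, d ≠ j' → d.1 ≤ z := fun d hd hne =>
      hz.1 ⟨d, ⟨hd, hne⟩, rfl⟩
    have hzx : z ≤ x := hz.2 (by rintro _ ⟨d, hd, rfl⟩; exact dle d hd.1)
    have z1 : z ≤ (κ j).1 := hz.2 (by
      rintro _ ⟨d, hd, rfl⟩
      exact ne_le (h1 d (Or.inl hd) j (Or.inr rfl)) (fun e => hjD (e ▸ hd.1)))
    have z2 : z ≤ (κ j').1 := hz.2 (by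
      rintro _ ⟨d, hd, rfl⟩
      exact ne_le (hD d hd.1 j' hj') hd.2)
    have e1 : z ⊔ j.1 = x := by
      refine low _ (sup_le hzx hjx) fun d hd => ?_
      by_cases hdj : d = j'
      · exact ⟨j.1, le_sup_right, hdj ▸ hedge.2⟩
      · exact ⟨d.1, (hzd d hd hdj).trans le_sup_left, pr_not_le hκ d⟩
    have e2 : z ⊔ j'.1 = x := by
      refine low _ (sup_le hzx (dle _ hj')) fun d hd => ⟨d.1, ?_, pr_not_le hκ d⟩
      by_cases hdj : d = j'
      · exact hdj ▸ le_sup_right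
      · exact (hzd d hd hdj).trans le_sup_left
    exact hedge.1 (hB z j j' z1 z2 (e1.trans e2.symm))
  · rintro j j' hj hj' hedge ⟨-, h2, -, h4⟩
    have hjD : j ∉ DLabel κ x := fun h => hj (Or.inl h)
    have hjU : j ∉ ULabel κ x := fun h => hj (Or.inr h)
    have hjx : x ≤ (κ j).1 := lowx _ fun d hd =>
      ne_le (h4 d hd j (Or.inr rfl)) (fun e => hjD (e ▸ hd))
    obtain ⟨z, hz⟩ := pr_exGLB ((fun d => (κ d).1) '' (ULabel κ x \ {j'}))
    have hzd : ∀ d ∈ ULabel κ x, d ≠ j' → z ≤ (κ d).1 := fun d hd hne =>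
      hz.1 ⟨d, ⟨hd, hne⟩, rfl⟩
    have hzx : x ≤ z := hz.2 (by rintro _ ⟨d, hd, rfl⟩; exact ule d hd.1)
    have z1 : j.1 ≤ z := hz.2 (by
      rintro _ ⟨d, hd, rfl⟩
      exact ne_le (h2 j (Or.inr rfl) d (Or.inl hd)) (fun e => hjU (e ▸ hd.1)))
    have z2 : j'.1 ≤ z := hz.2 (by
      rintro _ ⟨d, hd, rfl⟩
      exact ne_le (hU j' hj' d hd.1) (Ne.symm hd.2))
    have e1 : z ⊓ (κ j).1 = x := by
      refine high _ (le_inf hzx hjx) fun d hd => ?_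
      by_cases hdj : d = j'
      · exact ⟨(κ j).1, inf_le_right, hdj ▸ hedge.2⟩
      · exact ⟨(κ d).1, inf_le_left.trans (hzd d hd hdj), pr_not_le hκ d⟩
    have e2 : z ⊓ (κ j').1 = x := by
      refine high _ (le_inf hzx (ule _ hj')) fun d hd => ⟨(κ d).1, ?_, pr_not_le hκ d⟩
      by_cases hdj : d = j'
      · exact hdj ▸ inf_le_right
      · exact inf_le_left.trans (hzd d hd hdj)
    exact hedge.1 (hB' z j j' z1 z2 (e1.trans e2.symm)).symm
end

section
/- If L and L' are finite semidistrim lattices, then the product lattice L × L' (with componentwise order, meet, and join) is semidistrim. -/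
universe u

namespace SD

variable {α β γ : Type u} [Lattice α] [Lattice β] [Lattice γ]

def Cp (j m : α) : Prop :=
  JoinIrred j ∧ MeetIrred m ∧ (∀ jst, jst ⋖ j → Maximal (fun z : α => j ⊓ z = jst) m) ∧
    (∀ mst, m ⋖ mst → Minimal (fun z : α => m ⊔ z = mst) j)

def IsPR (r : α → α → Prop) : Prop :=
  (∀ j m, r j m → Cp j m) ∧ (∀ j, JoinIrred j → ∃! m, r j m) ∧ (∀ m, MeetIrred m → ∃! j, r j m)

def UPR (r : α → α → Prop) : Prop := IsPR r ∧ ∀ r', IsPR r' → r' = r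

def relOf (κ : {j : α // JoinIrred j} → {m : α // MeetIrred m}) (j m : α) : Prop :=
  ∃ hj, (κ ⟨j, hj⟩).1 = m

def upRel (r : α → α → Prop) (j0 : α) (x m : ↥(Set.Ici j0)) : Prop :=
  ∃ j, r j m.1 ∧ j0 ⊔ j = x.1

def dnRel (r : α → α → Prop) (m0 : α) (j y : ↥(Set.Iic m0)) : Prop :=
  ∃ m, r j.1 m ∧ m0 ⊓ m = y.1

lemma relOf_self (κ : {j : α // JoinIrred j} → {m : α // MeetIrred m}) (j) :
    relOf κ j.1 (κ j).1 := ⟨j.2, rfl⟩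

lemma relOf_inj {κ κ' : {j : α // JoinIrred j} → {m : α // MeetIrred m}}
    (h : relOf κ = relOf κ') : κ = κ' := by
  funext j
  have := relOf_self κ j
  rw [h] at this
  obtain ⟨_, h⟩ := this
  exact Subtype.ext h.symm

lemma pairing_iff (κ : {j : α // JoinIrred j} → {m : α // MeetIrred m}) :
    IsPairing κ ↔ IsPR (relOf κ) := by
  constructor
  · rintro ⟨hb, h1, h2⟩
    refine ⟨?_, ?_, ?_⟩
    · rintro j m ⟨hj, rfl⟩
      exact ⟨hj, (κ _).2, h1 ⟨j, hj⟩, h2 ⟨j, hj⟩⟩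
    · intro j hj
      exact ⟨_, ⟨hj, rfl⟩, fun y ⟨_, h⟩ => h.symm⟩
    · intro m hm
      obtain ⟨j, hj⟩ := hb.2 ⟨m, hm⟩
      refine ⟨j.1, ⟨j.2, by simp [hj]⟩, ?_⟩
      rintro y ⟨hy, h⟩
      have : κ ⟨y, hy⟩ = κ j := by rw [hj]; exact Subtype.ext h
      exact congrArg Subtype.val (hb.1 this)
  · rintro ⟨h1, h2, h3⟩
    refine ⟨⟨?_, ?_⟩, ?_, ?_⟩
    · intro a b hab
      have ha := relOf_self κ a
      have hb := relOf_self κ b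
      rw [hab] at ha
      exact Subtype.ext ((h3 _ (κ b).2).unique ha hb)
    · intro m
      obtain ⟨j, ⟨hj, h⟩, -⟩ := h3 m.1 m.2
      exact ⟨⟨j, hj⟩, Subtype.ext h⟩
    · intro j; exact (h1 _ _ (relOf_self κ j)).2.2.1
    · intro j; exact (h1 _ _ (relOf_self κ j)).2.2.2

lemma exists_relOf {r : α → α → Prop} (h : IsPR r) :
    ∃ κ : {j : α // JoinIrred j} → {m : α // MeetIrred m}, relOf κ = r := by
  choose f hf using fun j : {j : α // JoinIrred j} => (h.2.1 j.1 j.2).exists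
  refine ⟨fun j => ⟨f j, (h.1 _ _ (hf j)).2.1⟩, ?_⟩
  funext j m
  apply propext
  constructor
  · rintro ⟨hj, rfl⟩; exact hf ⟨j, hj⟩
  · intro hr
    have hj := (h.1 _ _ hr).1
    exact ⟨hj, (h.2.1 j hj).unique (hf ⟨j, hj⟩) hr⟩

lemma upr_iff (κ : {j : α // JoinIrred j} → {m : α // MeetIrred m}) :
    UPR (relOf κ) ↔ IsPairing κ ∧ ∀ κ', IsPairing κ' → κ' = κ := by
  constructor
  · rintro ⟨h1, h2⟩
    exact ⟨(pairing_iff κ).2 h1, fun κ' h => relOf_inj (h2 _ ((pairing_iff κ').1 h))⟩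
  · rintro ⟨h1, h2⟩
    refine ⟨(pairing_iff κ).1 h1, fun r' h => ?_⟩
    obtain ⟨κ', rfl⟩ := exists_relOf h
    rw [h2 κ' ((pairing_iff κ').2 h)]

inductive CDR : (β : Type u) → [Lattice β] → [Finite β] → Prop
  | singleton (β : Type u) [Lattice β] [Finite β] (h : Nat.card β = 1) : CDR β
  | step (β : Type u) [Lattice β] [Finite β] (r : β → β → Prop) (hr : UPR r) (j0 m0 : β)
      (hpp : IsPrimePair j0 m0) (hup : CDR ↥(Set.Ici j0)) (hdn : CDR ↥(Set.Iic m0))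
      (hru : UPR (upRel r j0)) (hrd : UPR (dnRel r m0)) : CDR β

lemma cdr_of_cd {β : Type u} [Lattice β] [Finite β] (h : CompatiblyDismantlable β) : CDR β := by
  induction h with
  | singleton β h => exact .singleton β h
  | step β κ hκ huniq j0 m0 hpp hup hdn κup hκup hκupuniq κdn hκdn hκdnuniq halpha halphainj
      halphasurj hbeta hbetainj hbetasurj ihu ihd =>
    refine .step β (relOf κ) ((upr_iff κ).2 ⟨hκ, huniq⟩) j0 m0 hpp ihu ihd ?_ ?_
    · have : upRel (relOf κ) j0 = relOf κup := by
        funext x m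
        apply propext
        constructor
        · rintro ⟨j, ⟨hj, h⟩, hx⟩
          obtain ⟨hji, h'⟩ := halpha ⟨j, hj⟩ (by rw [h]; exact m.2)
          obtain ⟨x, hx0⟩ := x
          subst hx
          exact ⟨hji, Subtype.ext (h'.trans h)⟩
        · rintro ⟨hx, rfl⟩
          obtain ⟨j, h1, h2⟩ := halphasurj ⟨x, hx⟩
          refine ⟨j.1, ⟨j.2, ?_⟩, h2⟩
          obtain ⟨hji, h'⟩ := halpha j h1
          obtain ⟨x, hx0⟩ := x
          dsimp at h2
          subst h2
          exact h'.symm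
      rw [this]
      exact (upr_iff κup).2 ⟨hκup, hκupuniq⟩
    · have : dnRel (relOf κ) m0 = relOf κdn := by
        funext j y
        apply propext
        constructor
        · rintro ⟨m, ⟨hj, h⟩, hy⟩
          obtain ⟨hji, h'⟩ := hbeta ⟨j, hj⟩ j.2
          exact ⟨hji, Subtype.ext (h'.trans (by rw [← hy, ← h]))⟩
        · rintro ⟨hj, rfl⟩
          obtain ⟨i, h1, h2⟩ := hbetasurj (κdn ⟨j, hj⟩)
          obtain ⟨hji, h'⟩ := hbeta i h1
          have h3 : κdn ⟨⟨i.1, h1⟩, hji⟩ = κdn ⟨j, hj⟩ :=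
            Subtype.ext (Subtype.ext (h'.trans h2))
          have h4 := congrArg (fun t => t.1.1) (hκdn.1.1 h3)
          dsimp at h4
          exact ⟨(κ i).1, h4 ▸ relOf_self κ i, h2⟩
      rw [this]
      exact (upr_iff κdn).2 ⟨hκdn, hκdnuniq⟩

lemma cd_of_cdr {β : Type u} [Lattice β] [Finite β] (h : CDR β) : CompatiblyDismantlable β := by
  induction h with
  | singleton β h => exact .singleton β h
  | step β r hr j0 m0 hpp hup hdn hru hrd ihu ihd =>
    obtain ⟨κ, rfl⟩ := exists_relOf hr.1
    obtain ⟨κup, hκu⟩ := exists_relOf hru.1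
    obtain ⟨κdn, hκd⟩ := exists_relOf hrd.1
    have hru' := hru
    have hrd' := hrd
    rw [← hκu, upr_iff] at hru'
    rw [← hκd, upr_iff] at hrd'
    have hκ := (upr_iff κ).1 hr
    have key1 : ∀ j (h : j0 ≤ (κ j).1),
        relOf κup ⟨j0 ⊔ j.1, Set.mem_Ici.mpr le_sup_left⟩ ⟨(κ j).1, h⟩ := by
      intro j h
      rw [hκu]
      exact ⟨j.1, relOf_self κ j, rfl⟩
    have key2 : ∀ j (h : j.1 ≤ m0),
        relOf κdn ⟨j.1, h⟩ ⟨m0 ⊓ (κ j).1, Set.mem_Iic.mpr inf_le_left⟩ := by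
      intro j h
      rw [hκd]
      exact ⟨_, relOf_self κ j, rfl⟩
    refine .step β κ hκ.1 hκ.2 j0 m0 hpp ihu ihd κup hru'.1 hru'.2 κdn hrd'.1 hrd'.2
      ?_ ?_ ?_ ?_ ?_ ?_
    · intro j h
      obtain ⟨h1, h2⟩ := key1 j h
      exact ⟨h1, congrArg Subtype.val h2⟩
    · intro j j' h h' he
      obtain ⟨h1, h2⟩ := key1 j h
      obtain ⟨h3, h4⟩ := key1 j' h'
      apply hκ.1.1.1
      apply Subtype.ext
      have h2 := congrArg Subtype.val h2
      have h4 := congrArg Subtype.val h4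
      dsimp only at h2 h4
      rw [← h2, ← h4]
      simp only [he]
    · intro j'
      have := relOf_self κup j'
      rw [hκu] at this
      obtain ⟨j, ⟨h1, h2⟩, h3⟩ := this
      exact ⟨⟨j, h1⟩, by rw [h2]; exact (κup j').1.2, h3⟩
    · intro j h
      obtain ⟨h1, h2⟩ := key2 j h
      exact ⟨h1, congrArg Subtype.val h2⟩
    · intro j j' h h' he
      have h1 := key2 j h
      have h2 := key2 j' h'
      have hp := (pairing_iff κdn).1 hrd'.1
      have e : (⟨m0 ⊓ (κ j).1, Set.mem_Iic.mpr inf_le_left⟩ : ↥(Set.Iic m0)) =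
        ⟨m0 ⊓ (κ j').1, Set.mem_Iic.mpr inf_le_left⟩ := Subtype.ext he
      rw [e] at h1
      have := (hp.2.2 _ (hp.1 _ _ h2).2.1).unique h1 h2
      exact Subtype.ext (congrArg (fun t => t.1) this)
    · intro m'
      obtain ⟨j, hj⟩ := hrd'.1.1.2 m'
      have := relOf_self κdn j
      rw [hκd, hj] at this
      obtain ⟨m, ⟨h1, h2⟩, h3⟩ := this
      exact ⟨⟨j.1, h1⟩, j.1.2, by rw [h2]; exact h3⟩

/-! transport -/

lemma ji_iso (e : α ≃o γ) (j : α) : JoinIrred (e j) ↔ JoinIrred j := by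
  simp [JoinIrred, ExistsUnique, e.surjective.exists, e.surjective.forall]

lemma mi_iso (e : α ≃o γ) (j : α) : MeetIrred (e j) ↔ MeetIrred j := by
  simp [MeetIrred, ExistsUnique, e.surjective.exists, e.surjective.forall]

lemma cp_iso (e : α ≃o γ) (j m : α) : Cp (e j) (e m) ↔ Cp j m := by
  simp [Cp, ji_iso, mi_iso, Maximal, Minimal, e.surjective.forall, ← map_inf, ← map_sup]

def tr (e : α ≃o γ) (r : α → α → Prop) (x y : γ) : Prop := r (e.symm x) (e.symm y)

lemma ispr_iso (e : α ≃o γ) {r : α → α → Prop} (h : IsPR r) : IsPR (tr e r) := by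
  obtain ⟨h1, h2, h3⟩ := h
  refine ⟨?_, ?_, ?_⟩
  · simpa [e.surjective.forall, cp_iso, tr] using h1
  · simpa [e.surjective.forall, e.surjective.exists, ji_iso, tr, ExistsUnique] using h2
  · simpa [e.surjective.forall, e.surjective.exists, mi_iso, tr, ExistsUnique] using h3

lemma upr_iso (e : α ≃o γ) {r : α → α → Prop} (h : UPR r) : UPR (tr e r) := by
  refine ⟨ispr_iso e h.1, fun r' h' => ?_⟩
  have := h.2 _ (ispr_iso e.symm h')
  rw [← this]
  funext x y
  simp [tr]

def iciIso (e : α ≃o γ) (a : α) (c : γ) (h : e a = c) : ↥(Set.Ici a) ≃o ↥(Set.Ici c) where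
  toFun x := ⟨e x.1, by rw [← h]; exact e.monotone x.2⟩
  invFun x := ⟨e.symm x.1, by
    have : x.1 ∈ _ := x.2
    subst h
    exact (e.le_symm_apply).2 this⟩
  left_inv x := by simp
  right_inv x := by simp
  map_rel_iff' := by intro x y; simp [← Subtype.coe_le_coe]

def iicIso (e : α ≃o γ) (a : α) (c : γ) (h : e a = c) : ↥(Set.Iic a) ≃o ↥(Set.Iic c) where
  toFun x := ⟨e x.1, by rw [← h]; exact e.monotone x.2⟩
  invFun x := ⟨e.symm x.1, by
    have : x.1 ∈ _ := x.2
    subst h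
    exact (e.symm_apply_le).2 this⟩
  left_inv x := by simp
  right_inv x := by simp
  map_rel_iff' := by intro x y; simp [← Subtype.coe_le_coe]

lemma cdr_iso {α : Type u} [Lattice α] [Finite α] (h : CDR α) :
    ∀ {γ : Type u} [Lattice γ] [Finite γ], (α ≃o γ) → CDR γ := by
  induction h with
  | singleton α h =>
    intro γ _ _ e
    exact .singleton γ (by rw [← h]; exact (Nat.card_congr e.toEquiv).symm)
  | step α r hr j0 m0 hpp hup hdn hru hrd ihu ihd =>
    intro γ _ _ e
    refine .step γ (tr e r) (upr_iso e hr) (e j0) (e m0) ?_ (ihu (iciIso e j0 _ rfl))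
      (ihd (iicIso e m0 _ rfl)) ?_ ?_
    · intro z
      obtain ⟨z, rfl⟩ := e.surjective z
      simpa using hpp z
    · convert upr_iso (iciIso e j0 _ rfl) hru using 1
      funext x m
      obtain ⟨x, rfl⟩ := (iciIso e j0 _ rfl).surjective x
      obtain ⟨m, rfl⟩ := (iciIso e j0 _ rfl).surjective m
      simp [tr, upRel, e.surjective.exists]
      simp [iciIso, ← map_sup]
    · convert upr_iso (iicIso e m0 _ rfl) hrd using 1
      funext x m
      obtain ⟨x, rfl⟩ := (iicIso e m0 _ rfl).surjective x
      obtain ⟨m, rfl⟩ := (iicIso e m0 _ rfl).surjective m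
      simp [tr, dnRel, e.surjective.exists]
      simp [iicIso, ← map_inf]

/-! products -/

lemma exists_isBot [Finite α] [Nonempty α] : ∃ b : α, IsBot b := by
  obtain ⟨b, hb⟩ := (Set.finite_univ (α := α)).exists_minimal Set.univ_nonempty
  refine ⟨b, IsMin.isBot ?_⟩
  intro c hc
  exact hb.2 trivial hc

lemma exists_isTop [Finite α] [Nonempty α] : ∃ b : α, IsTop b := exists_isBot (α := αᵒᵈ)

lemma bot_or_cov [Finite α] (x : α) : IsBot x ∨ ∃ y, y ⋖ x := by
  by_cases h : IsBot x
  · exact Or.inl h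
  · right
    simp only [IsBot, not_forall] at h
    obtain ⟨z, hz⟩ := h
    have h1 : z ⊓ x < x := lt_of_le_of_ne inf_le_right (fun h => hz (inf_eq_right.1 h))
    obtain ⟨y, -, hy⟩ := exists_le_covBy_of_lt h1
    exact ⟨y, hy⟩

lemma top_or_cov [Finite α] (x : α) : IsTop x ∨ ∃ y, x ⋖ y := by
  by_cases h : IsTop x
  · exact Or.inl h
  · right
    simp only [IsTop, not_forall] at h
    obtain ⟨z, hz⟩ := h
    have h1 : x < x ⊔ z := lt_of_le_of_ne le_sup_left (fun h => hz (left_eq_sup.1 h))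
    obtain ⟨y, hy, -⟩ := exists_covBy_le_of_lt h1
    exact ⟨y, hy⟩

lemma not_cov_bot {y : α} (h : IsBot y) (z : α) : ¬ z ⋖ y := fun hz => hz.lt.not_ge (h z)
lemma not_cov_top {y : α} (h : IsTop y) (z : α) : ¬ y ⋖ z := fun hz => hz.lt.not_ge (h z)
lemma JI_nb {x : α} (h : JoinIrred x) : ¬ IsBot x := by
  intro hb
  obtain ⟨y, hy, -⟩ := h
  exact not_cov_bot hb y hy
lemma MI_nt {x : α} (h : MeetIrred x) : ¬ IsTop x := by
  intro hb
  obtain ⟨y, hy, -⟩ := h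
  exact not_cov_top hb y hy

lemma ji_left {x : α} {y : β} (hy : IsBot y) : JoinIrred (x, y) ↔ JoinIrred x := by
  constructor
  · rintro ⟨⟨a, b⟩, h, hu⟩
    simp only [Prod.mk_covBy_mk_iff, not_cov_bot hy, false_and, or_false] at h
    exact ⟨a, h.1, fun c hc => congrArg Prod.fst (hu (c, y) (by simp [Prod.mk_covBy_mk_iff, hc]))⟩
  · rintro ⟨a, h, hu⟩
    refine ⟨(a, y), by simp [Prod.mk_covBy_mk_iff, h], ?_⟩
    rintro ⟨c, d⟩ h'
    simp only [Prod.mk_covBy_mk_iff, not_cov_bot hy, false_and, or_false] at h'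
    rw [h'.2, hu c h'.1]

lemma mi_left {x : α} {y : β} (hy : IsTop y) : MeetIrred (x, y) ↔ MeetIrred x := by
  constructor
  · rintro ⟨⟨a, b⟩, h, hu⟩
    simp only [Prod.mk_covBy_mk_iff, not_cov_top hy, false_and, or_false] at h
    exact ⟨a, h.1, fun c hc => congrArg Prod.fst (hu (c, y) (by simp [Prod.mk_covBy_mk_iff, hc]))⟩
  · rintro ⟨a, h, hu⟩
    refine ⟨(a, y), by simp [Prod.mk_covBy_mk_iff, h], ?_⟩
    rintro ⟨c, d⟩ h'
    simp only [Prod.mk_covBy_mk_iff, not_cov_top hy, false_and, or_false] at h'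
    rw [← h'.2, hu c h'.1]

lemma ji_swap {x : α} {y : β} : JoinIrred (x, y) ↔ JoinIrred (y, x) :=
  (ji_iso (OrderIso.prodComm (α := α) (β := β)) (x, y)).symm
lemma mi_swap {x : α} {y : β} : MeetIrred (x, y) ↔ MeetIrred (y, x) :=
  (mi_iso (OrderIso.prodComm (α := α) (β := β)) (x, y)).symm
lemma cp_swap {x m : α} {y n : β} : Cp (x, y) (m, n) ↔ Cp (y, x) (n, m) :=
  (cp_iso (OrderIso.prodComm (α := α) (β := β)) (x, y) (m, n)).symm

lemma ji_prod [Finite α] [Finite β] {x : α} {y : β} (h : JoinIrred (x, y)) :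
    (JoinIrred x ∧ IsBot y) ∨ (JoinIrred y ∧ IsBot x) := by
  rcases bot_or_cov y with hy | ⟨b, hb⟩
  · exact Or.inl ⟨(ji_left hy).1 h, hy⟩
  rcases bot_or_cov x with hx | ⟨a, ha⟩
  · exact Or.inr ⟨(ji_left hx).1 (ji_swap.1 h), hx⟩
  have := h.unique (y₁ := (a, y)) (y₂ := (x, b)) (by simp [Prod.mk_covBy_mk_iff, ha])
    (by simp [Prod.mk_covBy_mk_iff, hb])
  exact absurd (congrArg Prod.fst this) ha.ne

lemma mi_prod [Finite α] [Finite β] {x : α} {y : β} (h : MeetIrred (x, y)) :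
    (MeetIrred x ∧ IsTop y) ∨ (MeetIrred y ∧ IsTop x) := by
  rcases top_or_cov y with hy | ⟨b, hb⟩
  · exact Or.inl ⟨(mi_left hy).1 h, hy⟩
  rcases top_or_cov x with hx | ⟨a, ha⟩
  · exact Or.inr ⟨(mi_left hx).1 (mi_swap.1 h), hx⟩
  have := h.unique (y₁ := (a, y)) (y₂ := (x, b)) (by simp [Prod.mk_covBy_mk_iff, ha])
    (by simp [Prod.mk_covBy_mk_iff, hb])
  exact absurd (congrArg Prod.fst this) ha.ne'

lemma cp_left {x m : α} {y n : β} (hy : IsBot y) (hn : IsTop n) :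
    Cp (x, y) (m, n) ↔ Cp x m := by
  have i1 : ∀ z, y ⊓ z = y := fun z => inf_eq_left.2 (hy z)
  have i2 : ∀ z, n ⊔ z = n := fun z => sup_eq_left.2 (hn z)
  unfold Cp
  rw [ji_left hy, mi_left hn]
  refine and_congr_right fun _ => and_congr_right fun _ => and_congr ?_ ?_
  · constructor
    · intro h a ha
      have := h (a, y) (by simp [Prod.mk_covBy_mk_iff, ha])
      refine ⟨by simpa [i1] using this.1, fun z hz hle => ?_⟩
      exact (this.2 (y := (z, n)) (by simp [i1, hz]) ⟨hle, le_rfl⟩).1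
    · rintro h ⟨a, b⟩ hab
      simp only [Prod.mk_covBy_mk_iff, not_cov_bot hy, false_and, or_false] at hab
      have := h a hab.1
      refine ⟨by simpa [i1, hab.2] using this.1, ?_⟩
      rintro ⟨z, w⟩ hz hle
      simp only [Prod.mk_inf_mk, Prod.mk.injEq] at hz
      exact ⟨this.2 hz.1 hle.1, hn w⟩
  · constructor
    · intro h a ha
      have := h (a, n) (by simp [Prod.mk_covBy_mk_iff, ha])
      refine ⟨by simpa [i2] using this.1, fun z hz hle => ?_⟩
      exact (this.2 (y := (z, y)) (by simp [i2, hz]) ⟨hle, le_rfl⟩).1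
    · rintro h ⟨a, b⟩ hab
      simp only [Prod.mk_covBy_mk_iff, not_cov_top hn, false_and, or_false] at hab
      have := h a hab.1
      refine ⟨by simpa [i2, ← hab.2] using this.1, ?_⟩
      rintro ⟨z, w⟩ hz hle
      simp only [Prod.mk_sup_mk, Prod.mk.injEq] at hz
      exact ⟨this.2 hz.1 hle.1, hy w⟩

lemma cp_nle {x m : α} (h : Cp x m) : ¬ x ≤ m := by
  intro hle
  obtain ⟨a, ha, -⟩ := h.1
  have : x ⊓ m = a := (h.2.2.1 a ha).1
  rw [inf_eq_left.2 hle] at this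
  exact ha.ne this.symm

def prodRel (r : α → α → Prop) (s : β → β → Prop) (p q : α × β) : Prop :=
  (r p.1 q.1 ∧ IsBot p.2 ∧ IsTop q.2) ∨ (s p.2 q.2 ∧ IsBot p.1 ∧ IsTop q.1)

lemma cp_prod [Finite α] [Finite β] (p q : α × β) : Cp p q ↔ prodRel Cp Cp p q := by
  obtain ⟨x, y⟩ := p
  obtain ⟨m, n⟩ := q
  constructor
  · intro h
    have hn := cp_nle h
    rcases ji_prod h.1 with ⟨h1, h2⟩ | ⟨h1, h2⟩ <;> rcases mi_prod h.2.1 with ⟨h3, h4⟩ | ⟨h3, h4⟩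
    · exact Or.inl ⟨(cp_left h2 h4).1 h, h2, h4⟩
    · exact absurd ⟨h4 x, h2 n⟩ hn
    · exact absurd ⟨h2 m, h4 y⟩ hn
    · exact Or.inr ⟨(cp_left h2 h4).1 (cp_swap.1 h), h2, h4⟩
  · rintro (⟨h, h2, h4⟩ | ⟨h, h2, h4⟩)
    · exact (cp_left h2 h4).2 h
    · exact cp_swap.2 ((cp_left h2 h4).2 h)

lemma isBot_eq {a b : α} (h : IsBot a) (h' : IsBot b) : a = b := le_antisymm (h b) (h' a)
lemma isTop_eq {a b : α} (h : IsTop a) (h' : IsTop b) : a = b := le_antisymm (h' a) (h b)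

lemma ispr_left [Finite α] [Finite β] {r' : α × β → α × β → Prop} (h : IsPR r') {b t : β}
    (hb : IsBot b) (ht : IsTop t) : IsPR (fun x m => r' (x, b) (m, t)) := by
  obtain ⟨h1, h2, h3⟩ := h
  refine ⟨fun j m hr => (cp_left hb ht).1 (h1 _ _ hr), ?_, ?_⟩
  · intro j hj
    obtain ⟨⟨m, n⟩, hr, hu⟩ := h2 (j, b) ((ji_left hb).2 hj)
    rcases (cp_prod _ _).1 (h1 _ _ hr) with ⟨h4, h5, h6⟩ | ⟨h4, h5, h6⟩
    · obtain rfl := isTop_eq ht h6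
      exact ⟨m, hr, fun m' hm' => congrArg Prod.fst (hu _ hm')⟩
    · exact absurd h5 (JI_nb hj)
  · intro m hm
    obtain ⟨⟨x, y⟩, hr, hu⟩ := h3 (m, t) ((mi_left ht).2 hm)
    rcases (cp_prod _ _).1 (h1 _ _ hr) with ⟨h4, h5, h6⟩ | ⟨h4, h5, h6⟩
    · obtain rfl := isBot_eq hb h5
      exact ⟨x, hr, fun m' hm' => congrArg Prod.fst (hu _ hm')⟩
    · exact absurd h6 (MI_nt hm)

lemma ispr_right [Finite α] [Finite β] {r' : α × β → α × β → Prop} (h : IsPR r') {b t : α}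
    (hb : IsBot b) (ht : IsTop t) : IsPR (fun x m => r' (b, x) (t, m)) :=
  ispr_left (ispr_iso (OrderIso.prodComm (α := α) (β := β)) h) hb ht

lemma upr_prod [Finite α] [Finite β] [Nonempty α] [Nonempty β] {r : α → α → Prop}
    {s : β → β → Prop} (hr : UPR r) (hs : UPR s) : UPR (prodRel r s) := by
  obtain ⟨b, hb⟩ := exists_isBot (α := α)
  obtain ⟨t, ht⟩ := exists_isTop (α := α)
  obtain ⟨b', hb'⟩ := exists_isBot (α := β)
  obtain ⟨t', ht'⟩ := exists_isTop (α := β)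
  obtain ⟨⟨r1, r2, r3⟩, hru⟩ := hr
  obtain ⟨⟨s1, s2, s3⟩, hsu⟩ := hs
  refine ⟨⟨?_, ?_, ?_⟩, ?_⟩
  · rintro p q h
    rw [cp_prod]
    exact h.imp (fun h => ⟨r1 _ _ h.1, h.2⟩) (fun h => ⟨s1 _ _ h.1, h.2⟩)
  · rintro ⟨x, y⟩ h
    rcases ji_prod h with ⟨h1, h2⟩ | ⟨h1, h2⟩
    · obtain ⟨m, hm, hu⟩ := r2 x h1
      refine ⟨(m, t'), Or.inl ⟨hm, h2, ht'⟩, ?_⟩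
      rintro ⟨m', n'⟩ (⟨h3, h4, h5⟩ | ⟨h3, h4, h5⟩)
      · exact Prod.ext (hu m' h3) (isTop_eq h5 ht')
      · exact absurd h4 (JI_nb h1)
    · obtain ⟨m, hm, hu⟩ := s2 y h1
      refine ⟨(t, m), Or.inr ⟨hm, h2, ht⟩, ?_⟩
      rintro ⟨m', n'⟩ (⟨h3, h4, h5⟩ | ⟨h3, h4, h5⟩)
      · exact absurd h4 (JI_nb h1)
      · exact Prod.ext (isTop_eq h5 ht) (hu n' h3)
  · rintro ⟨x, y⟩ h
    rcases mi_prod h with ⟨h1, h2⟩ | ⟨h1, h2⟩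
    · obtain ⟨m, hm, hu⟩ := r3 x h1
      refine ⟨(m, b'), Or.inl ⟨hm, hb', h2⟩, ?_⟩
      rintro ⟨m', n'⟩ (⟨h3, h4, h5⟩ | ⟨h3, h4, h5⟩)
      · exact Prod.ext (hu m' h3) (isBot_eq h4 hb')
      · exact absurd h5 (MI_nt h1)
    · obtain ⟨m, hm, hu⟩ := s3 y h1
      refine ⟨(b, m), Or.inr ⟨hm, hb, h2⟩, ?_⟩
      rintro ⟨m', n'⟩ (⟨h3, h4, h5⟩ | ⟨h3, h4, h5⟩)
      · exact absurd h5 (MI_nt h1)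
      · exact Prod.ext (isBot_eq h4 hb) (hu n' h3)
  · intro r' h'
    rw [← hru _ (ispr_left h' hb' ht'), ← hsu _ (ispr_right h' hb ht)]
    funext p q
    obtain ⟨x, y⟩ := p
    obtain ⟨m, n⟩ := q
    apply propext
    constructor
    · intro h
      rcases (cp_prod _ _).1 (h'.1 _ _ h) with ⟨h4, h5, h6⟩ | ⟨h4, h5, h6⟩
      · refine Or.inl ⟨?_, h5, h6⟩
        obtain rfl := isBot_eq h5 hb'
        obtain rfl := isTop_eq h6 ht'
        exact h
      · refine Or.inr ⟨?_, h5, h6⟩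
        obtain rfl := isBot_eq h5 hb
        obtain rfl := isTop_eq h6 ht
        exact h
    · rintro (⟨h4, h5, h6⟩ | ⟨h4, h5, h6⟩)
      · obtain rfl := isBot_eq h5 hb'
        obtain rfl := isTop_eq h6 ht'
        exact h4
      · obtain rfl := isBot_eq h5 hb
        obtain rfl := isTop_eq h6 ht
        exact h4

def iciProd (a : α) (b : β) (hb : IsBot b) :
    ↥(Set.Ici a) × β ≃o ↥(Set.Ici ((a, b) : α × β)) where
  toFun p := ⟨(p.1.1, p.2), ⟨p.1.2, hb _⟩⟩
  invFun p := (⟨p.1.1, p.2.1⟩, p.1.2)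
  left_inv _ := rfl
  right_inv _ := rfl
  map_rel_iff' := Iff.rfl

def iicProd (a : α) (b : β) (hb : IsTop b) :
    ↥(Set.Iic a) × β ≃o ↥(Set.Iic ((a, b) : α × β)) where
  toFun p := ⟨(p.1.1, p.2), ⟨p.1.2, hb _⟩⟩
  invFun p := (⟨p.1.1, p.2.1⟩, p.1.2)
  left_inv _ := rfl
  right_inv _ := rfl
  map_rel_iff' := Iff.rfl

lemma cdr_nonempty {α : Type u} [Lattice α] [Finite α] (h : CDR α) : Nonempty α := by
  cases h with
  | singleton _ h => exact (Nat.card_pos_iff.1 (by omega)).1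
  | step _ r hr j0 => exact ⟨j0⟩

lemma cdr_upr {α : Type u} [Lattice α] [Finite α] (h : CDR α) : ∃ r : α → α → Prop, UPR r := by
  cases h with
  | singleton _ h =>
    have hs : Subsingleton α := (Nat.card_eq_one_iff_unique.1 h).1
    have hb : ∀ x : α, IsBot x := fun x y => (Subsingleton.elim x y).le
    have ht : ∀ x : α, IsTop x := fun x y => (Subsingleton.elim y x).le
    refine ⟨fun _ _ => False, ⟨fun _ _ h => h.elim, fun j hj => absurd (hb j) (JI_nb hj),
      fun j hj => absurd (ht j) (MI_nt hj)⟩, fun r' h' => ?_⟩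
    funext x y
    apply propext
    exact ⟨fun h => JI_nb (h'.1 _ _ h).1 (hb x), False.elim⟩
  | step _ r hr j0 => exact ⟨r, hr⟩

lemma cdr_prod {α : Type u} [Lattice α] [Finite α] (h : CDR α) {β : Type u} [Lattice β] [Finite β]
    (hβ : CDR β) : CDR (α × β) := by
  have nb := cdr_nonempty hβ
  obtain ⟨s, hs⟩ := cdr_upr hβ
  obtain ⟨b', hb'⟩ := exists_isBot (α := β)
  obtain ⟨t', ht'⟩ := exists_isTop (α := β)
  induction h with
  | singleton α h =>
    obtain ⟨hs, ⟨a⟩⟩ := Nat.card_eq_one_iff_unique.1 h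
    refine cdr_iso hβ (γ := α × β)
      { toFun := fun y => (a, y), invFun := fun p => p.2, left_inv := fun _ => rfl,
        right_inv := fun p => Prod.ext (Subsingleton.elim _ _) rfl,
        map_rel_iff' := ?_ }
    intro x y
    exact ⟨fun h => h.2, fun h => ⟨le_rfl, h⟩⟩
  | step α r hr j0 m0 hpp hup hdn hru hrd ihu ihd =>
    have na : Nonempty α := ⟨j0⟩
    have n1 : Nonempty ↥(Set.Ici j0) := ⟨⟨j0, le_rfl⟩⟩
    have n2 : Nonempty ↥(Set.Iic m0) := ⟨⟨m0, le_rfl⟩⟩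
    obtain ⟨b, hb⟩ := exists_isBot (α := α)
    obtain ⟨t, ht⟩ := exists_isTop (α := α)
    refine .step _ (prodRel r s) (upr_prod hr hs) (j0, b') (m0, t') ?_
      (cdr_iso ihu (iciProd j0 b' hb')) (cdr_iso ihd (iicProd m0 t' ht')) ?_ ?_
    · rintro ⟨z, w⟩
      have := hpp z
      simpa [Prod.mk_le_mk, hb' w, ht' w] using this
    · convert upr_iso (iciProd j0 b' hb') (upr_prod hru hs) using 1
      funext x m
      obtain ⟨⟨⟨x, hx⟩, y⟩, rfl⟩ := (iciProd j0 b' hb').surjective x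
      obtain ⟨⟨⟨m, hm⟩, n⟩, rfl⟩ := (iciProd j0 b' hb').surjective m
      simp only [tr, OrderIso.symm_apply_apply]
      apply propext
      constructor
      · rintro ⟨⟨c, d⟩, h1, h2⟩
        have h3 : j0 ⊔ c = x := congrArg Prod.fst h2
        have h4 : d = y := (sup_eq_right.2 (hb' d)).symm.trans (congrArg Prod.snd h2)
        subst h4
        rcases h1 with ⟨h5, h6, h7⟩ | ⟨h5, h6, h7⟩
        · exact Or.inl ⟨⟨c, h5, h3⟩, h6, h7⟩
        · refine Or.inr ⟨h5, fun z => ?_, fun z => h7 z.1⟩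
          change x ≤ z.1
          rw [← h3, sup_eq_left.2 (h6 j0)]
          exact z.2
      · rintro (⟨⟨c, h5, h3⟩, h6, h7⟩ | ⟨h5, h6, h7⟩)
        · exact ⟨(c, y), Or.inl ⟨h5, h6, h7⟩, Prod.ext h3 (sup_eq_right.2 (hb' y))⟩
        · have h8 : x = j0 := le_antisymm (h6 ⟨j0, le_rfl⟩) hx
          have h9 : IsTop m := by
            have : t ≤ m := h7 ⟨t, ht j0⟩
            exact fun z => (ht z).trans this
          exact ⟨(b, y), Or.inr ⟨h5, hb, h9⟩,
            Prod.ext ((sup_eq_left.2 (hb j0)).trans h8.symm) (sup_eq_right.2 (hb' y))⟩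
    · convert upr_iso (iicProd m0 t' ht') (upr_prod hrd hs) using 1
      funext x m
      obtain ⟨⟨⟨x, hx⟩, y⟩, rfl⟩ := (iicProd m0 t' ht').surjective x
      obtain ⟨⟨⟨m, hm⟩, n⟩, rfl⟩ := (iicProd m0 t' ht').surjective m
      simp only [tr, OrderIso.symm_apply_apply]
      apply propext
      constructor
      · rintro ⟨⟨c, d⟩, h1, h2⟩
        have h3 : m0 ⊓ c = m := congrArg Prod.fst h2
        have h4 : d = n := (inf_eq_right.2 (ht' d)).symm.trans (congrArg Prod.snd h2)
        subst h4
        rcases h1 with ⟨h5, h6, h7⟩ | ⟨h5, h6, h7⟩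
        · exact Or.inl ⟨⟨c, h5, h3⟩, h6, h7⟩
        · refine Or.inr ⟨h5, fun z => h6 z.1, fun z => ?_⟩
          change z.1 ≤ m
          rw [← h3, inf_eq_left.2 (h7 m0)]
          exact z.2
      · rintro (⟨⟨c, h5, h3⟩, h6, h7⟩ | ⟨h5, h6, h7⟩)
        · exact ⟨(c, n), Or.inl ⟨h5, h6, h7⟩, Prod.ext h3 (inf_eq_right.2 (ht' n))⟩
        · have h8 : m = m0 := le_antisymm hm (h7 ⟨m0, le_rfl⟩)
          have h9 : IsBot x := by
            have : x ≤ b := h6 ⟨b, hb m0⟩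
            exact fun z => this.trans (hb z)
          exact ⟨(t, n), Or.inr ⟨h5, h9, ht⟩,
            Prod.ext ((inf_eq_left.2 (ht m0)).trans h8.symm) (inf_eq_right.2 (ht' n))⟩

def IndR (r : α → α → Prop) : Prop :=
  (∀ x y y' j m j' m' : α, y ⋖ x → y' ⋖ x → r j m → r j' m' → j ≤ x → y ≤ m → j' ≤ x → y' ≤ m' →
    j ≠ j' → j ≤ m') ∧
  (∀ x y y' j m j' m' : α, x ⋖ y → x ⋖ y' → r j m → r j' m' → j ≤ y → x ≤ m → j' ≤ y' → x ≤ m' →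
    j ≠ j' → j ≤ m')

lemma ind_iff (κ : {j : α // JoinIrred j} → {m : α // MeetIrred m}) :
    (∀ x, IndepSet κ (DLabel κ x) ∧ IndepSet κ (ULabel κ x)) ↔ IndR (relOf κ) := by
  constructor
  · intro h
    constructor
    · rintro x y y' j _ j' _ hy hy' ⟨hj, rfl⟩ ⟨hj', rfl⟩ h1 h2 h3 h4 hne
      have := (h x).1 ⟨j, hj⟩ ⟨y, hy, h1, h2⟩ ⟨j', hj'⟩ ⟨y', hy', h3, h4⟩
      by_contra hc
      exact this ⟨fun e => hne (congrArg Subtype.val e), hc⟩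
    · rintro x y y' j _ j' _ hy hy' ⟨hj, rfl⟩ ⟨hj', rfl⟩ h1 h2 h3 h4 hne
      have := (h x).2 ⟨j, hj⟩ ⟨y, hy, h1, h2⟩ ⟨j', hj'⟩ ⟨y', hy', h3, h4⟩
      by_contra hc
      exact this ⟨fun e => hne (congrArg Subtype.val e), hc⟩
  · rintro ⟨hd, hu⟩ x
    constructor
    · rintro j ⟨y, hy, h1, h2⟩ j' ⟨y', hy', h3, h4⟩ ⟨hne, hc⟩
      exact hc (hd x y y' j _ j' _ hy hy' (relOf_self κ j) (relOf_self κ j') h1 h2 h3 h4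
        (fun e => hne (Subtype.ext e)))
    · rintro j ⟨y, hy, h1, h2⟩ j' ⟨y', hy', h3, h4⟩ ⟨hne, hc⟩
      exact hc (hu x y y' j _ j' _ hy hy' (relOf_self κ j) (relOf_self κ j') h1 h2 h3 h4
        (fun e => hne (Subtype.ext e)))

lemma cov_left {y x : α × β} (h : y ⋖ x) {j m : α} (h1 : j ≤ x.1) (h2 : y.1 ≤ m)
    (hn : ¬ j ≤ m) : y.1 ⋖ x.1 := by
  rcases Prod.covBy_iff.1 h with h | h
  · exact h.1
  · exact absurd (h1.trans (h.2 ▸ h2)) hn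

lemma cov_right {y x : α × β} (h : y ⋖ x) {j m : β} (h1 : j ≤ x.2) (h2 : y.2 ≤ m)
    (hn : ¬ j ≤ m) : y.2 ⋖ x.2 := by
  rcases Prod.covBy_iff.1 h with h | h
  · exact absurd (h1.trans (h.2 ▸ h2)) hn
  · exact h.1

lemma ind_prod {r : α → α → Prop} {s : β → β → Prop} (hr : IsPR r) (hs : IsPR s)
    (ir : IndR r) (is : IndR s) : IndR (prodRel r s) := by
  have nr : ∀ {j m}, r j m → ¬ j ≤ m := fun h => cp_nle (hr.1 _ _ h)
  have ns : ∀ {j m}, s j m → ¬ j ≤ m := fun h => cp_nle (hs.1 _ _ h)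
  constructor
  · rintro x y y' j m j' m' hy hy' (⟨a, b, c⟩ | ⟨a, b, c⟩) (⟨a', b', c'⟩ | ⟨a', b', c'⟩) h1 h2 h3 h4 hne
    · exact ⟨ir.1 x.1 y.1 y'.1 _ _ _ _ (cov_left hy h1.1 h2.1 (nr a)) (cov_left hy' h3.1 h4.1 (nr a'))
        a a' h1.1 h2.1 h3.1 h4.1 (fun e => hne (Prod.ext e (isBot_eq b b'))), b _⟩
    · exact ⟨c' _, b _⟩
    · exact ⟨b _, c' _⟩
    · exact ⟨b _, is.1 x.2 y.2 y'.2 _ _ _ _ (cov_right hy h1.2 h2.2 (ns a))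
        (cov_right hy' h3.2 h4.2 (ns a'))
        a a' h1.2 h2.2 h3.2 h4.2 (fun e => hne (Prod.ext (isBot_eq b b') e))⟩
  · rintro x y y' j m j' m' hy hy' (⟨a, b, c⟩ | ⟨a, b, c⟩) (⟨a', b', c'⟩ | ⟨a', b', c'⟩) h1 h2 h3 h4 hne
    · exact ⟨ir.2 x.1 y.1 y'.1 _ _ _ _ (cov_left hy h1.1 h2.1 (nr a)) (cov_left hy' h3.1 h4.1 (nr a'))
        a a' h1.1 h2.1 h3.1 h4.1 (fun e => hne (Prod.ext e (isBot_eq b b'))), b _⟩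
    · exact ⟨c' _, b _⟩
    · exact ⟨b _, c' _⟩
    · exact ⟨b _, is.2 x.2 y.2 y'.2 _ _ _ _ (cov_right hy h1.2 h2.2 (ns a))
        (cov_right hy' h3.2 h4.2 (ns a'))
        a a' h1.2 h2.2 h3.2 h4.2 (fun e => hne (Prod.ext (isBot_eq b b') e))⟩

lemma sd_ind {α : Type u} [Lattice α] [Finite α] (h : Semidistrim α) :
    ∃ r : α → α → Prop, UPR r ∧ IndR r := by
  obtain ⟨r, hr⟩ := cdr_upr (cdr_of_cd h.1)
  obtain ⟨κ, rfl⟩ := exists_relOf hr.1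
  exact ⟨_, hr, (ind_iff κ).1 (h.2 κ ((pairing_iff κ).2 hr.1))⟩

end SD

/-- a product of finite semidistrim lattices is semidistrim. -/
theorem stmt14 {α β : Type u} [Lattice α] [Finite α] [Lattice β] [Finite β]
    (hα : Semidistrim α) (hβ : Semidistrim β) :
    Semidistrim (α × β) := by
  have ca := SD.cdr_of_cd hα.1
  have cb := SD.cdr_of_cd hβ.1
  have na := SD.cdr_nonempty ca
  have nb := SD.cdr_nonempty cb
  obtain ⟨r, hr, ir⟩ := SD.sd_ind hα
  obtain ⟨s, hs, is⟩ := SD.sd_ind hβ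
  refine ⟨SD.cd_of_cdr (SD.cdr_prod ca cb), fun κ hκ => ?_⟩
  rw [SD.ind_iff, (SD.upr_prod hr hs).2 _ ((SD.pairing_iff κ).1 hκ)]
  exact SD.ind_prod hr.1 hs.1 ir is
end
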